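/- arXiv:1810.03894 — 6 statements merged into one kernel-verified Lean document; each statement's English description precedes it below -/
import Mathlib

section
/- Let G be an OTG with n ≥ 5 vertices and let G_w = C_w(G) be its weak closure. Then h(G) = n − 2 if G_w ≅ K_2 ∨ (K_m + K_{n−m−2}) for some 1 ≤ m < n/2; h(G) = n/2 if n is even and G_w ≅ K_{n/2} ∨ K^c_{n/2} or G_w ≅ K_{n/2,n/2}; and h(G) = n in all remaining cases (that is, if G_w is complete, or G_w = Z_{n−m} ∨ K_m with n even, 0 ≤ m < n/2, every vertex of Z_{n−m} of degree n/2 in G_w, and G_w is not isomorphic to K_2 ∨ (K_{n/2−1} + K_{n/2−1}) or K_{n/2,n/2}). -/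
open Finset SimpleGraph
open scoped Classical

/-- `X` is a Hamiltonian cycle enforcing set (H-force set) of `G`: `X` is nonempty and
every cycle of `G` containing all vertices of `X` is a Hamiltonian cycle. -/
def IsHForceSet {V : Type*} [Fintype V] [DecidableEq V] (G : SimpleGraph V)
    (X : Finset V) : Prop :=
  X.Nonempty ∧ ∀ (v : V) (c : G.Walk v v), c.IsCycle → (∀ x ∈ X, x ∈ c.support) →
    c.IsHamiltonianCycle

/-- The H-force number of `G`: the smallest cardinality of an H-force set of `G`. -/
noncomputable def hForce {V : Type*} [Fintype V] [DecidableEq V] (G : SimpleGraph V) : ℕ :=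
  sInf {k | ∃ X : Finset V, IsHForceSet G X ∧ X.card = k}

/-- `G` satisfies the condition of Ore's theorem: `d(u) + d(v) ≥ n` for every pair of
nonadjacent vertices `u, v`. -/
def IsOTG {V : Type*} [Fintype V] (G : SimpleGraph V) : Prop :=
  ∀ u v : V, u ≠ v → ¬G.Adj u v → Fintype.card V ≤ G.degree u + G.degree v

/-- One step of the weak-closure process: `H` is obtained from `G` by joining one pair of
nonadjacent vertices whose degree sum is at least `n + 1`. -/
def WeakStep {V : Type*} [Fintype V] (G H : SimpleGraph V) : Prop :=
  ∃ u v : V, u ≠ v ∧ ¬G.Adj u v ∧ Fintype.card V + 1 ≤ G.degree u + G.degree v ∧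
    H = G ⊔ SimpleGraph.edge u v

/-- `H` is a weak closure of `G`: it is obtained from `G` by a finite sequence of weak-closure
steps, and no pair of nonadjacent vertices of `H` has degree sum at least `n + 1`. -/
def IsWeakClosure {V : Type*} [Fintype V] (G H : SimpleGraph V) : Prop :=
  Relation.ReflTransGen WeakStep G H ∧
    ∀ u v : V, u ≠ v → ¬H.Adj u v → H.degree u + H.degree v < Fintype.card V + 1

/-- The join `G ∨ H` of two graphs on disjoint vertex sets: their disjoint union together
with all edges between the two sides. -/
def graphJoin {α β : Type*} (G : SimpleGraph α) (H : SimpleGraph β) : SimpleGraph (α ⊕ β) :=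
  (G ⊕g H) ⊔ completeBipartiteGraph α β

/-- `G` has the form `Z_{n-m} ∨ K_m`, where every vertex of `Z_{n-m}` has degree `n / 2` in the
whole graph: there is a set `S` of `m` vertices each adjacent to all other vertices (the `K_m`
part), and every vertex outside `S` has degree `n / 2`. -/
def IsZJoinK {V : Type*} [Fintype V] [DecidableEq V] (G : SimpleGraph V) (m : ℕ) : Prop :=
  ∃ S : Finset V, S.card = m ∧ (∀ x ∈ S, ∀ y : V, y ≠ x → G.Adj x y) ∧
    ∀ z : V, z ∉ S → 2 * G.degree z = Fintype.card V

section CycleOn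

variable {V : Type*} {G : SimpleGraph V} {s : Finset V} {p : ℕ → V}

/-- The number of neighbours of `x` lying in `s`. -/
noncomputable def degreeOn (G : SimpleGraph V) (s : Finset V) (x : V) : ℕ :=
  #{y ∈ s | G.Adj x y}

/-- `p 0, p 1, …` enumerates `s` along a path of `G`. -/
structure IsPathOn (G : SimpleGraph V) (s : Finset V) (p : ℕ → V) : Prop where
  mem : ∀ i < #s, p i ∈ s
  inj : ∀ i < #s, ∀ j < #s, p i = p j → i = j
  adj : ∀ i, i + 1 < #s → G.Adj (p i) (p (i + 1))

/-- `p 0, p 1, …` enumerates `s` along a cycle of `G`. -/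
structure IsCycleOn (G : SimpleGraph V) (s : Finset V) (p : ℕ → V) : Prop
    extends IsPathOn G s p where
  three_le : 3 ≤ #s
  adj_last : G.Adj (p (#s - 1)) (p 0)

/-- `G` has a cycle with vertex set `s`. -/
def HasCycleOn (G : SimpleGraph V) (s : Finset V) : Prop :=
  ∃ p, IsCycleOn G s p

theorem IsPathOn.exists_eq (hp : IsPathOn G s p) {x : V} (hx : x ∈ s) :
    ∃ i < #s, p i = x := by
  have hs : (range #s).image p = s := by
    apply eq_of_subset_of_card_le
    · intro y hy
      obtain ⟨i, hi, rfl⟩ := mem_image.1 hy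
      exact hp.mem i (mem_range.1 hi)
    · rw [card_image_of_injOn, card_range]
      intro i hi j hj h
      exact hp.inj i (by simpa using hi) j (by simpa using hj) h
  rw [← hs] at hx
  simpa using hx

/-- Rotation of a cycle. -/
theorem IsCycleOn.rotate (hp : IsCycleOn G s p) {a : ℕ} (ha : a < #s) :
    IsCycleOn G s (fun t => p (if a + t < #s then a + t else a + t - #s)) where
  mem i hi := hp.mem _ (by split_ifs <;> omega)
  inj i hi j hj h := by
    have := hp.inj _ (by split_ifs <;> omega) _ (by split_ifs <;> omega) h
    split_ifs at this <;> omega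
  adj i hi := by
    have h1 := hp.three_le
    by_cases h2 : a + i + 1 < #s
    · rw [if_pos (by omega), if_pos (by omega)]
      exact hp.adj (a + i) h2
    by_cases h3 : a + i + 1 = #s
    · rw [if_pos (by omega), if_neg (by omega)]
      convert hp.adj_last using 2 <;> omega
    · rw [if_neg (by omega), if_neg (by omega)]
      convert hp.adj (a + i - #s) (by omega) using 2
      omega
  three_le := hp.three_le
  adj_last := by
    have h1 := hp.three_le
    by_cases h3 : a = 0
    · rw [if_pos (by omega), if_pos (by omega)]
      convert hp.adj_last using 2 <;> omega
    · rw [if_neg (by omega), if_pos (by omega)]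
      convert hp.adj (a - 1) (by omega) using 2 <;> omega

/-- Crossing chords from the two ends of a path close it to a cycle. -/
theorem IsPathOn.hasCycleOn_of_cross (hp : IsPathOn G s p) (h3 : 3 ≤ #s) {i : ℕ}
    (hi : i + 1 < #s) (h0 : G.Adj (p 0) (p (i + 1))) (h1 : G.Adj (p i) (p (#s - 1))) :
    HasCycleOn G s := by
  refine ⟨fun t => p (if t ≤ i then t else #s + i - t), ⟨?_, ?_, ?_⟩, h3, ?_⟩
  · intro t ht
    exact hp.mem _ (by split_ifs <;> omega)
  · intro a ha b hb h
    have := hp.inj _ (by split_ifs <;> omega) _ (by split_ifs <;> omega) h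
    split_ifs at this <;> omega
  · intro t ht
    by_cases h2 : t + 1 ≤ i
    · simpa [h2, show t ≤ i by omega] using hp.adj t (by omega)
    by_cases h4 : t = i
    · subst h4
      convert h1 using 2
      · simp
      · simp; omega
    · convert (hp.adj (#s + i - (t + 1)) (by omega)).symm using 2
      · rw [if_neg (by omega)]; omega
      · rw [if_neg (by omega)]
  · convert h0.symm using 2
    · rw [if_neg (by omega)]; omega
    · simp

theorem IsPathOn.degreeOn_zero (hp : IsPathOn G s p) :
    degreeOn G s (p 0) = #{i ∈ range (#s - 1) | G.Adj (p 0) (p (i + 1))} := by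
  symm
  apply card_bij (fun i _ => p (i + 1))
  · intro i hi
    simp only [mem_filter, mem_range] at hi ⊢
    exact ⟨hp.mem _ (by omega), hi.2⟩
  · intro i hi j hj h
    simp only [mem_filter, mem_range] at hi hj
    have := hp.inj _ (by omega) _ (by omega) h
    omega
  · intro y hy
    simp only [mem_filter] at hy
    obtain ⟨i, hi, rfl⟩ := hp.exists_eq hy.1
    obtain _ | i := i
    · exact absurd hy.2 G.irrefl
    · exact ⟨i, by simp only [mem_filter, mem_range]; exact ⟨by omega, hy.2⟩, rfl⟩

theorem IsPathOn.degreeOn_last (hp : IsPathOn G s p) :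
    degreeOn G s (p (#s - 1)) = #{i ∈ range (#s - 1) | G.Adj (p i) (p (#s - 1))} := by
  symm
  apply card_bij (fun i _ => p i)
  · intro i hi
    simp only [mem_filter, mem_range] at hi ⊢
    exact ⟨hp.mem _ (by omega), hi.2.symm⟩
  · intro i hi j hj h
    simp only [mem_filter, mem_range] at hi hj
    exact hp.inj _ (by omega) _ (by omega) h
  · intro y hy
    simp only [mem_filter] at hy
    obtain ⟨i, hi, rfl⟩ := hp.exists_eq hy.1
    refine ⟨i, ?_, rfl⟩
    simp only [mem_filter, mem_range]
    refine ⟨?_, hy.2.symm⟩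
    by_contra h
    have : i = #s - 1 := by omega
    exact G.irrefl (this ▸ hy.2)

/-- In a path that cannot be closed, the two end degrees count disjoint sets of positions. -/
theorem IsPathOn.card_cross (hp : IsPathOn G s p) (h3 : 3 ≤ #s) (hc : ¬HasCycleOn G s) :
    #{i ∈ range (#s - 1) | G.Adj (p 0) (p (i + 1)) ∨ G.Adj (p i) (p (#s - 1))} =
      degreeOn G s (p 0) + degreeOn G s (p (#s - 1)) := by
  rw [hp.degreeOn_zero, hp.degreeOn_last, filter_or, card_union_of_disjoint]
  rw [disjoint_filter]
  intro i hi h0 h1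
  exact hc (hp.hasCycleOn_of_cross h3 (by have := mem_range.1 hi; omega) h0 h1)

theorem IsPathOn.hasCycleOn_of_degreeOn (hp : IsPathOn G s p) (h3 : 3 ≤ #s)
    (hd : #s ≤ degreeOn G s (p 0) + degreeOn G s (p (#s - 1))) : HasCycleOn G s := by
  by_contra hc
  rw [← hp.card_cross h3 hc] at hd
  have := hd.trans (card_filter_le _ _)
  rw [card_range] at this
  omega

theorem IsPathOn.adj_or_adj (hp : IsPathOn G s p) (h3 : 3 ≤ #s) (hc : ¬HasCycleOn G s)
    (hd : #s - 1 ≤ degreeOn G s (p 0) + degreeOn G s (p (#s - 1))) {i : ℕ} (hi : i + 1 < #s) :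
    G.Adj (p 0) (p (i + 1)) ∨ G.Adj (p i) (p (#s - 1)) := by
  rw [← hp.card_cross h3 hc] at hd
  have := eq_of_subset_of_card_le (filter_subset _ _) (by rwa [card_range])
  exact filter_eq_self.1 this i (by simp; omega)

theorem HasCycleOn.mono {G' : SimpleGraph V} (h : HasCycleOn G s) (hs : ∀ x ∈ s, ∀ y ∈ s,
    G.Adj x y → G'.Adj x y) : HasCycleOn G' s := by
  obtain ⟨p, hp⟩ := h
  have := hp.three_le
  exact ⟨p, ⟨hp.mem, hp.inj, fun i hi => hs _ (hp.mem _ (by omega)) _ (hp.mem _ hi) (hp.adj i hi)⟩,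
    hp.three_le, hs _ (hp.mem _ (by omega)) _ (hp.mem _ (by omega)) hp.adj_last⟩

/-- Bondy–Chvátal: an edge between vertices of large degree sum is not needed for a spanning
cycle. -/
theorem HasCycleOn.of_sup_edge {u v : V} (h : HasCycleOn (G ⊔ edge u v) s)
    (hd : u ∈ s → v ∈ s → #s ≤ degreeOn G s u + degreeOn G s v) : HasCycleOn G s := by
  obtain ⟨p, hp⟩ := h
  have h3 := hp.three_le
  have key : ∀ q, IsCycleOn (G ⊔ edge u v) s q → G.Adj (q (#s - 1)) (q 0) ∨
      (q (#s - 1) = u ∧ q 0 = v ∨ q (#s - 1) = v ∧ q 0 = u) := by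
    intro q hq
    have := hq.adj_last
    rw [sup_adj, edge_adj] at this
    tauto
  have done : ∀ q, IsCycleOn (G ⊔ edge u v) s q →
      (q (#s - 1) = u ∧ q 0 = v ∨ q (#s - 1) = v ∧ q 0 = u) → HasCycleOn G s := by
    intro q hq h
    have hqG : IsPathOn G s q := by
      refine ⟨hq.mem, hq.inj, fun i hi => ?_⟩
      have := hq.adj i hi
      rw [sup_adj, edge_adj] at this
      refine this.resolve_right ?_
      rintro ⟨h', -⟩
      have i1 := hq.inj i (by omega) 0 (by omega)
      have i2 := hq.inj (i + 1) (by omega) 0 (by omega)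
      have i3 := hq.inj (i + 1) (by omega) (#s - 1) (by omega)
      have i4 := hq.inj i (by omega) (#s - 1) (by omega)
      grind
    have m0 := hq.mem 0 (by omega)
    have m1 := hq.mem (#s - 1) (by omega)
    refine hqG.hasCycleOn_of_degreeOn h3 ?_
    rcases h with ⟨ha, hb⟩ | ⟨ha, hb⟩ <;> rw [ha] at m1 <;> rw [hb] at m0 <;> rw [ha, hb]
    · rw [add_comm]; exact hd m1 m0
    · exact hd m0 m1
  by_cases hall : ∃ i < #s, (p i = u ∧ p (if i + 1 < #s then i + 1 else 0) = v ∨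
      p i = v ∧ p (if i + 1 < #s then i + 1 else 0) = u)
  · obtain ⟨i, hi, h⟩ := hall
    by_cases h2 : i + 1 < #s
    · rw [if_pos h2] at h
      refine done _ (hp.rotate h2) ?_
      convert h using 4 <;> split_ifs <;> congr 1 <;> omega
    · have : i = #s - 1 := by omega
      rw [if_neg h2, this] at h
      exact done _ hp h
  · push Not at hall
    refine ⟨p, ⟨hp.mem, hp.inj, fun i hi => ?_⟩, h3, ?_⟩
    · have h := hall i (by omega)
      rw [if_pos hi] at h
      have := hp.adj i hi
      rw [sup_adj, edge_adj] at this
      tauto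
    · have h := hall (#s - 1) (by omega)
      rw [if_neg (by omega)] at h
      have := key p hp
      tauto
theorem degreeOn_mono {G' : SimpleGraph V} (h : G ≤ G') (s : Finset V) (x : V) :
    degreeOn G s x ≤ degreeOn G' s x :=
  card_le_card (monotone_filter_right _ fun _ _ hy => h hy)

theorem degreeOn_le_erase_add_one [DecidableEq V] (G : SimpleGraph V) (s : Finset V) (x v : V) :
    degreeOn G s x ≤ degreeOn G (s.erase v) x + 1 := by
  unfold degreeOn
  rw [filter_erase]
  have := pred_card_le_card_erase (s := {y ∈ s | G.Adj x y}) (a := v)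
  omega

theorem hasCycleOn_of_clique (h3 : 3 ≤ #s) (h : ∀ x ∈ s, ∀ y ∈ s, x ≠ y → G.Adj x y) :
    HasCycleOn G s := by
  have h0 : 0 < #s := by omega
  let e := s.equivFin.symm
  obtain ⟨q, hq⟩ : ∃ q : ℕ → V, ∀ i, ∀ hi : i < #s, q i = e ⟨i, hi⟩ :=
    ⟨fun i => if hi : i < #s then e ⟨i, hi⟩ else e ⟨0, h0⟩, fun i hi => dif_pos hi⟩
  have mem : ∀ i < #s, q i ∈ s := fun i hi => hq i hi ▸ (e _).2
  have inj : ∀ i < #s, ∀ j < #s, q i = q j → i = j := by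
    intro i hi j hj hij
    rw [hq i hi, hq j hj] at hij
    simpa using e.injective (Subtype.ext hij)
  have adj : ∀ i < #s, ∀ j < #s, i ≠ j → G.Adj (q i) (q j) := fun i hi j hj hij =>
    h _ (mem i hi) _ (mem j hj) fun heq => hij (inj i hi j hj heq)
  exact ⟨q, ⟨mem, inj, fun i hi => adj i (by omega) _ hi (by omega)⟩, h3,
    adj _ (by omega) _ h0 (by omega)⟩

/-- Ore's theorem for the subgraph induced by `s`. -/
theorem hasCycleOn_of_ore [Finite V] (h3 : 3 ≤ #s)
    (h : ∀ x ∈ s, ∀ y ∈ s, x ≠ y → ¬G.Adj x y → #s ≤ degreeOn G s x + degreeOn G s y) :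
    HasCycleOn G s := by
  induction G using WellFoundedGT.induction with
  | ind G ih =>
    by_cases hc : ∀ x ∈ s, ∀ y ∈ s, x ≠ y → G.Adj x y
    · exact hasCycleOn_of_clique h3 hc
    push Not at hc
    obtain ⟨u, hu, v, hv, huv, hadj⟩ := hc
    have hle : G ≤ G ⊔ edge u v := le_sup_left
    refine HasCycleOn.of_sup_edge (u := u) (v := v) (ih _ ?_ ?_) fun _ _ => h u hu v hv huv hadj
    · refine lt_of_le_of_ne hle fun heq => hadj ?_
      rw [heq, sup_adj, edge_adj]
      tauto
    · intro x hx y hy hxy hn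
      have := h x hx y hy hxy fun h' => hn (hle h')
      have := degreeOn_mono hle s x
      have := degreeOn_mono hle s y
      omega

theorem HasCycleOn.exists_isPathOn_erase [DecidableEq V] (h : HasCycleOn G s) {v : V}
    (hv : v ∈ s) : ∃ p, IsPathOn G (s.erase v) p := by
  obtain ⟨p, hp⟩ := h
  obtain ⟨a, ha, rfl⟩ := hp.exists_eq hv
  have hq := hp.rotate ha
  have h3 := hp.three_le
  have h0 : p (if a + 0 < #s then a + 0 else a + 0 - #s) = p a := by rw [if_pos (by omega)]; rfl
  set q := fun t => p (if a + t < #s then a + t else a + t - #s) with hqdef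
  change q 0 = p a at h0
  have hcard : #(s.erase (p a)) = #s - 1 := card_erase_of_mem hv
  refine ⟨fun i => q (i + 1), ?_, ?_, ?_⟩ <;> rw [hcard]
  · intro i hi
    rw [mem_erase, ← h0]
    refine ⟨fun h => ?_, hq.mem _ (by omega)⟩
    have := hq.inj (i + 1) (by omega) 0 (by omega) h
    omega
  · intro i hi j hj h
    have := hq.inj (i + 1) (by omega) (j + 1) (by omega) h
    omega
  · intro i hi
    exact hq.adj (i + 1) (by omega)

/-- If a cycle cannot be extended to a further vertex `u` that is joined to at least half of it,
then the successors of the neighbours of `u` form with `u` a large independent set. -/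
theorem IsCycleOn.exists_indep_of_insert [DecidableEq V] {u : V} {r : ℕ} (hp : IsCycleOn G s p)
    (hu : u ∉ s) (hc : ¬HasCycleOn G (insert u s)) (hd : r ≤ degreeOn G s u) :
    ∃ I ⊆ insert u s, #I = r + 1 ∧ ∀ x ∈ I, ∀ y ∈ I, ¬G.Adj x y := by
  have h3 := hp.three_le
  have hcard : #(insert u s) = #s + 1 := card_insert_of_notMem hu
  -- a chord between two successors of neighbours of `u` gives a longer cycle
  have chord : ∀ i < #s, ∀ j < #s, i < j →
      G.Adj u (p (if i = 0 then #s - 1 else i - 1)) → G.Adj u (p (j - 1)) →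
      G.Adj (p i) (p j) → HasCycleOn G (insert u s) := by
    intro i hi j hj hij h1 h2 h4
    let f : ℕ → ℕ := fun t => if t ≤ j - i then j - t else
      if t - 1 + i < #s then t - 1 + i else t - 1 + i - #s
    have hf : ∀ t, 1 ≤ t → t ≤ #s → f t < #s := by
      intro t ht ht'
      simp only [f]; split_ifs <;> omega
    refine ⟨fun t => if t = 0 then u else p (f t), ⟨?_, ?_, ?_⟩, by omega, ?_⟩
    · intro t ht
      split_ifs with h0
      · exact mem_insert_self _ _
      · exact mem_insert_of_mem (hp.mem _ (hf t (by omega) (by omega)))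
    · intro a ha b hb hab
      have hne : ∀ t, 1 ≤ t → t ≤ #s → u ≠ p (f t) := fun t ht ht' h =>
        hu (h ▸ hp.mem _ (hf t ht ht'))
      split_ifs at hab with ha0 hb0 hb0
      · omega
      · exact absurd hab (hne b (by omega) (by omega))
      · exact absurd hab.symm (hne a (by omega) (by omega))
      · have := hp.inj _ (hf a (by omega) (by omega)) _ (hf b (by omega) (by omega)) hab
        simp only [f] at this
        split_ifs at this <;> omega
    · intro t ht
      by_cases ht0 : t = 0
      · subst ht0
        have : f 1 = j - 1 := by simp only [f]; rw [if_pos (by omega)]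
        simpa [this] using h2
      simp only [ht0, if_false, Nat.succ_ne_zero]
      by_cases ht1 : t + 1 ≤ j - i
      · have e1 : f t = f (t + 1) + 1 := by
          simp only [f]; rw [if_pos (by omega), if_pos ht1]; omega
        rw [e1]
        have := hf t (by omega) (by omega)
        exact (hp.adj _ (by omega)).symm
      by_cases ht2 : t = j - i
      · have e1 : f t = i := by simp only [f]; rw [if_pos (by omega)]; omega
        have e2 : f (t + 1) = j := by
          simp only [f]; rw [if_neg (by omega), if_pos (by omega)]; omega
        rw [e1, e2]; exact h4
      by_cases ht3 : t + i = #s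
      · have e1 : f t = #s - 1 := by
          simp only [f]; rw [if_neg (by omega), if_pos (by omega)]; omega
        have e2 : f (t + 1) = 0 := by
          simp only [f]; rw [if_neg (by omega), if_neg (by omega)]; omega
        rw [e1, e2]; exact hp.adj_last
      · have e2 : f (t + 1) = f t + 1 := by
          simp only [f]; split_ifs <;> omega
        rw [e2]
        have := hf (t + 1) (by omega) (by omega)
        exact hp.adj _ (by omega)
    · have e1 : f #s = if i = 0 then #s - 1 else i - 1 := by
        simp only [f]; rw [if_neg (by omega)]; split_ifs <;> omega
      simp only [hcard, Nat.add_sub_cancel, if_true]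
      rw [if_neg (by omega), e1]
      exact h1.symm
  -- no two consecutive vertices are neighbours of `u`
  let pr : ℕ → ℕ := fun i => if i = 0 then #s - 1 else i - 1
  have hpr : ∀ i < #s, pr i < #s := by intro i hi; simp only [pr]; split_ifs <;> omega
  have consec : ∀ i < #s, G.Adj u (p (pr i)) → ¬G.Adj u (p i) := by
    intro i hi h1 h2
    have hq := hp.rotate hi
    set q := fun t => p (if i + t < #s then i + t else i + t - #s) with hqdef
    have q0 : q 0 = p i := by simp only [hqdef]; rw [if_pos (by omega)]; rfl
    have ql : q (#s - 1) = p (pr i) := by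
      simp only [hqdef, pr]; congr 1; split_ifs <;> omega
    refine hc ⟨fun t => if t = #s then u else q t, ⟨?_, ?_, ?_⟩, by omega, ?_⟩
    · intro t ht
      split_ifs with h0
      · exact mem_insert_self _ _
      · exact mem_insert_of_mem (hq.mem _ (by omega))
    · intro a ha b hb hab
      have hne : ∀ t < #s, u ≠ q t := fun t ht h => hu (h ▸ hq.mem _ ht)
      split_ifs at hab with ha0 hb0 hb0
      · omega
      · exact absurd hab (hne b (by omega))
      · exact absurd hab.symm (hne a (by omega))
      · exact hq.inj _ (by omega) _ (by omega) hab
    · intro t ht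
      rw [if_neg (by omega)]
      by_cases h : t + 1 = #s
      · rw [if_pos h, show t = #s - 1 by omega, ql]
        exact h1.symm
      · rw [if_neg h]
        exact hq.adj t (by omega)
    · simp only [hcard, Nat.add_sub_cancel, if_true]
      rw [if_neg (by omega), q0]
      exact h2
  have hcardI : degreeOn G s u ≤ #({i ∈ range #s | G.Adj u (p (pr i))}.image p) := by
    rw [card_image_of_injOn]
    · apply card_le_card_of_surjOn (fun i => p (pr i))
      intro y hy
      simp only [coe_filter, Set.mem_ofPred_eq] at hy
      obtain ⟨i, hi, rfl⟩ := hp.exists_eq hy.1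
      obtain ⟨j, hj, rfl⟩ : ∃ j < #s, pr j = i := by
        by_cases h : i + 1 < #s
        · exact ⟨i + 1, h, by simp [pr]⟩
        · exact ⟨0, by omega, by simp only [pr, if_true]; omega⟩
      refine ⟨j, ?_, rfl⟩
      simp only [coe_filter, Set.mem_ofPred_eq, mem_range]
      exact ⟨hj, hy.2⟩
    · intro i hi j hj h
      simp only [coe_filter, Set.mem_ofPred_eq, mem_range] at hi hj
      exact hp.inj _ hi.1 _ hj.1 h
  obtain ⟨J, hJ, hJr⟩ := exists_subset_card_eq (hd.trans hcardI)
  have hJ' : ∀ x ∈ J, ∃ i < #s, G.Adj u (p (pr i)) ∧ p i = x := by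
    intro x hx
    obtain ⟨i, hi, rfl⟩ := mem_image.1 (hJ hx)
    simp only [mem_filter, mem_range] at hi
    exact ⟨i, hi.1, hi.2, rfl⟩
  have hJs : J ⊆ s := by
    intro x hx
    obtain ⟨i, hi, -, rfl⟩ := hJ' x hx
    exact hp.mem i hi
  refine ⟨insert u J, insert_subset_insert u hJs, ?_, ?_⟩
  · rw [card_insert_of_notMem fun h => hu (hJs h), hJr]
  have hul : ∀ x ∈ J, ¬G.Adj u x := by
    intro x hx
    obtain ⟨i, hi, h, rfl⟩ := hJ' x hx
    exact consec i hi h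
  intro x hx y hy hxy
  rcases mem_insert.1 hx with hxu | hx <;> rcases mem_insert.1 hy with hyu | hy
  · exact G.irrefl (hxu.trans hyu.symm ▸ hxy)
  · exact hul y hy (hxu ▸ hxy)
  · exact hul x hx (hyu ▸ hxy.symm)
  · obtain ⟨i, hi, h1, rfl⟩ := hJ' x hx
    obtain ⟨j, hj, h2, rfl⟩ := hJ' y hy
    rcases lt_trichotomy i j with hij | rfl | hij
    · exact hc (chord i hi j hj hij h1 (by simpa [pr, show j ≠ 0 by omega] using h2) hxy)
    · exact G.irrefl hxy
    · exact hc (chord j hj i hi hij h2 (by simpa [pr, show i ≠ 0 by omega] using h1) hxy.symm)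

/-- A graph on `2 r + 1` vertices with a spanning path and minimum degree at least `r` has a
spanning cycle unless it has `r + 1` independent vertices or all but one of its vertices split
into two sets of size `r` without edges between them. -/
theorem IsPathOn.hasCycleOn_or [DecidableEq V] {r : ℕ} (hp : IsPathOn G s p) (hr : 2 ≤ r)
    (hs : #s = 2 * r + 1) (hd : ∀ x ∈ s, r ≤ degreeOn G s x) :
    HasCycleOn G s ∨ (∃ I ⊆ s, #I = r + 1 ∧ ∀ x ∈ I, ∀ y ∈ I, ¬G.Adj x y) ∨
      ∃ A B, A ⊆ s ∧ B ⊆ s ∧ #A = r ∧ #B = r ∧ Disjoint A B ∧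
        ∀ x ∈ A, ∀ y ∈ B, ¬G.Adj x y := by
  by_cases hc : HasCycleOn G s
  · exact Or.inl hc
  right
  have h3 : 3 ≤ #s := by omega
  have cross : ∀ i < 2 * r, G.Adj (p 0) (p (i + 1)) → ¬G.Adj (p i) (p (2 * r)) := by
    intro i hi h0 h1
    refine hc (hp.hasCycleOn_of_cross h3 (i := i) (by omega) h0 ?_)
    rw [hs]; exact h1
  have hd0 := hd _ (hp.mem 0 (by omega))
  have hd1 := hd _ (hp.mem (#s - 1) (by omega))
  have either : ∀ i < 2 * r, G.Adj (p 0) (p (i + 1)) ∨ G.Adj (p i) (p (2 * r)) := by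
    intro i hi
    have := hp.adj_or_adj h3 hc (by omega) (i := i) (by omega)
    rwa [hs] at this
  by_cases hex : ∃ i, 1 ≤ i ∧ i < 2 * r ∧ ¬G.Adj (p 0) (p i) ∧ G.Adj (p 0) (p (i + 1))
  · left
    obtain ⟨i, hi1, hi2, hn, ha⟩ := hex
    have hi3 : i ≠ 1 := by
      rintro rfl
      exact hn (hp.adj 0 (by omega))
    have hi4 : i + 1 ≠ 2 * r := fun h => by
      have := cross (2 * r - 1) (by omega) (by convert ha using 2; omega)
      apply this
      convert hp.adj (2 * r - 1) (by omega) using 2; omega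
    have hl : G.Adj (p (i - 1)) (p (2 * r)) :=
      (either (i - 1) (by omega)).resolve_left (by rwa [show i - 1 + 1 = i by omega])
    have hpi := hp.mem i (by omega)
    have hcard : #(s.erase (p i)) = 2 * r := by rw [card_erase_of_mem hpi, hs]; rfl
    let f : ℕ → ℕ := fun t => if t = 0 then 0 else if t ≤ 2 * r - i then i + t else 2 * r - t
    have hf : ∀ t < 2 * r, f t < #s ∧ f t ≠ i := by
      intro t ht
      simp only [f]; split_ifs <;> omega
    have hcyc : IsCycleOn G (s.erase (p i)) (fun t => p (f t)) := by
      refine ⟨⟨?_, ?_, ?_⟩, by omega, ?_⟩ <;> rw [hcard]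
      · intro t ht
        refine mem_erase.2 ⟨fun h => ?_, hp.mem _ (hf t ht).1⟩
        exact (hf t ht).2 (hp.inj _ (hf t ht).1 _ (by omega) h)
      · intro a ha b hb h
        have := hp.inj _ (hf a ha).1 _ (hf b hb).1 h
        simp only [f] at this
        split_ifs at this <;> omega
      · intro t ht
        by_cases h0 : t = 0
        · have e2 : f (t + 1) = i + 1 := by
            simp only [f]; rw [if_neg (by omega), if_pos (by omega)]; omega
          rw [e2]
          simpa [f, h0] using ha
        by_cases h1 : t + 1 ≤ 2 * r - i
        · have e2 : f (t + 1) = f t + 1 := by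
            simp only [f]; rw [if_neg h0, if_neg (by omega), if_pos (by omega), if_pos (by omega)]
            omega
          rw [e2]
          have := (hf (t + 1) ht).1
          exact hp.adj _ (by omega)
        by_cases h2 : t = 2 * r - i
        · have e1 : f t = 2 * r := by
            simp only [f]; rw [if_neg h0, if_pos (by omega)]; omega
          have e2 : f (t + 1) = i - 1 := by
            simp only [f]; rw [if_neg (by omega), if_neg (by omega)]; omega
          rw [e1, e2]; exact hl.symm
        · have e2 : f t = f (t + 1) + 1 := by
            simp only [f]; rw [if_neg h0, if_neg (by omega), if_neg (by omega), if_neg (by omega)]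
            omega
          rw [e2]
          have := (hf t (by omega)).1
          exact (hp.adj _ (by omega)).symm
      · have e1 : f (2 * r - 1) = 1 := by
          simp only [f]; rw [if_neg (by omega), if_neg (by omega)]; omega
        have e2 : f 0 = 0 := rfl
        rw [e1, e2]
        exact (hp.adj 0 (by omega)).symm
    have hdi : degreeOn G (s.erase (p i)) (p i) = degreeOn G s (p i) := by
      unfold degreeOn
      rw [filter_erase, erase_eq_of_notMem (by simp)]
    have := hcyc.exists_indep_of_insert (r := r) (notMem_erase _ _)
      (by rwa [insert_erase hpi]) (by rw [hdi]; exact hd _ hpi)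
    rwa [insert_erase hpi] at this
  · right
    push Not at hex
    have down : ∀ i, i + 1 ≤ 2 * r → G.Adj (p 0) (p (i + 1)) →
        ∀ j ≤ i, G.Adj (p 0) (p (j + 1)) := by
      intro i
      induction i with
      | zero => intro _ h j hj; rwa [show j = 0 by omega]
      | succ i ih =>
        intro hi h j hj
        rcases Nat.lt_or_ge j (i + 1) with h' | h'
        · refine ih (by omega) ?_ j (by omega)
          by_contra hn
          exact hex (i + 1) (by omega) (by omega) hn h
        · rwa [show j = i + 1 by omega]
    have hcc := hp.card_cross h3 hc
    have hle := (card_filter_le (range (#s - 1)) fun i =>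
      G.Adj (p 0) (p (i + 1)) ∨ G.Adj (p i) (p (#s - 1)))
    rw [hcc, card_range] at hle
    have hd0' : degreeOn G s (p 0) = r := by omega
    rw [hp.degreeOn_zero, hs] at hd0'
    have hT : {i ∈ range (2 * r + 1 - 1) | G.Adj (p 0) (p (i + 1))} = range r := by
      refine eq_of_subset_of_card_le ?_ (by rw [hd0', card_range])
      intro i hi
      simp only [mem_filter, mem_range] at hi
      have : range (i + 1) ⊆ {i ∈ range (2 * r + 1 - 1) | G.Adj (p 0) (p (i + 1))} := by
        intro j hj
        simp only [mem_filter, mem_range] at hj ⊢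
        exact ⟨by omega, down i (by omega) hi.2 j (by omega)⟩
      have := card_le_card this
      rw [hd0', card_range] at this
      exact mem_range.2 (by omega)
    have first : ∀ i < 2 * r, G.Adj (p 0) (p (i + 1)) ↔ i < r := by
      intro i hi
      have := congrArg (i ∈ ·) hT
      simp only [mem_filter, mem_range, eq_iff_iff] at this
      rw [← this]
      exact ⟨fun h => ⟨by omega, h⟩, fun h => h.2⟩
    have last : ∀ i < 2 * r, r ≤ i → G.Adj (p i) (p (2 * r)) := by
      intro i hi hri
      exact (either i hi).resolve_left fun h => by have := (first i hi).1 h; omega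
    have inj : ∀ a b, b ≤ 2 * r + 1 → Set.InjOn p (Finset.Ico a b) := by
      intro a b hb i hi j hj h
      simp only [coe_Ico, Set.mem_Ico] at hi hj
      exact hp.inj i (by omega) j (by omega) h
    refine ⟨(Ico 0 r).image p, (Ico (r + 1) (2 * r + 1)).image p, ?_, ?_, ?_, ?_, ?_, ?_⟩
    · intro x hx
      obtain ⟨i, hi, rfl⟩ := mem_image.1 hx
      exact hp.mem i (by have := mem_Ico.1 hi; omega)
    · intro x hx
      obtain ⟨i, hi, rfl⟩ := mem_image.1 hx
      exact hp.mem i (by have := mem_Ico.1 hi; omega)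
    · rw [card_image_of_injOn (inj _ _ (by omega)), Nat.card_Ico]; rfl
    · rw [card_image_of_injOn (inj _ _ (by omega)), Nat.card_Ico]; omega
    · rw [Finset.disjoint_left]
      intro x hx hy
      obtain ⟨i, hi, rfl⟩ := mem_image.1 hx
      obtain ⟨j, hj, h⟩ := mem_image.1 hy
      rw [mem_Ico] at hi hj
      have := hp.inj _ (by omega) _ (by omega) h
      omega
    · intro x hx y hy hadj
      obtain ⟨j, hj, rfl⟩ := mem_image.1 hx
      obtain ⟨i, hi, rfl⟩ := mem_image.1 hy
      rw [mem_Ico] at hi hj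
      have a1 : G.Adj (p 0) (p (j + 1)) := (first j (by omega)).2 hj.2
      have a2 : G.Adj (p (i - 1)) (p (2 * r)) := last _ (by omega) (by omega)
      refine hc ⟨fun t => p (if t ≤ j then j - t else if t < i then t else 2 * r + i - t),
        ⟨?_, ?_, ?_⟩, h3, ?_⟩
      · intro t ht
        exact hp.mem _ (by split_ifs <;> omega)
      · intro a ha b hb h
        have := hp.inj _ (by split_ifs <;> omega) _ (by split_ifs <;> omega) h
        split_ifs at this <;> omega
      · intro t ht
        by_cases h1 : t + 1 ≤ j
        · rw [if_pos (by omega), if_pos h1]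
          convert (hp.adj (j - (t + 1)) (by omega)).symm using 2; omega
        by_cases h2 : t = j
        · rw [if_pos (by omega), if_neg h1, if_pos (by omega)]
          convert a1 using 2 <;> omega
        by_cases h4 : t + 1 < i
        · rw [if_neg (by omega), if_pos (by omega), if_neg h1, if_pos h4]
          exact hp.adj t (by omega)
        by_cases h5 : t + 1 = i
        · rw [if_neg (by omega), if_pos (by omega), if_neg h1, if_neg h4]
          convert a2 using 2 <;> omega
        · rw [if_neg (by omega), if_neg (by omega), if_neg h1, if_neg h4]
          convert (hp.adj (2 * r + i - (t + 1)) (by omega)).symm using 2; omega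
      · rw [if_neg (by omega), if_neg (by omega), if_pos (by omega)]
        convert hadj.symm using 2 <;> omega

end CycleOn

section HForce

variable {V : Type*} {G H : SimpleGraph V}

theorem exists_walk_of_adj {q : ℕ → V} {m : ℕ} (h : ∀ i < m, G.Adj (q i) (q (i + 1))) :
    ∃ w : G.Walk (q 0) (q m), w.support = (List.range (m + 1)).map q ∧
      w.edges = (List.range m).map fun i => s(q i, q (i + 1)) := by
  induction m with
  | zero => exact ⟨Walk.nil, by simp, by simp⟩
  | succ m ih =>
    obtain ⟨w, hw, hw'⟩ := ih fun i hi => h i (by omega)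
    refine ⟨w.concat (h m (by omega)), ?_, ?_⟩
    · rw [Walk.support_concat, hw, List.range_succ (n := m + 1), List.map_append]
      simp
    · rw [Walk.edges_concat, hw', List.range_succ (n := m), List.map_append]
      simp

theorem HasCycleOn.exists_isCycle {s : Finset V} (h : HasCycleOn G s) :
    ∃ (v : V) (c : G.Walk v v), c.IsCycle ∧ ∀ x, x ∈ c.support ↔ x ∈ s := by
  obtain ⟨q, hq⟩ := h
  have h3 := hq.three_le
  obtain ⟨w, hw, hw'⟩ := exists_walk_of_adj (G := G) (q := q) (m := #s - 1)
    fun i hi => hq.adj i (by omega)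
  rw [show #s - 1 + 1 = #s by omega] at hw
  have hsupp : ∀ x, x ∈ w.support ↔ x ∈ s := by
    intro x
    simp only [hw, List.mem_map, List.mem_range]
    constructor
    · rintro ⟨i, hi, rfl⟩
      exact hq.mem i hi
    · exact hq.exists_eq
  refine ⟨_, Walk.cons hq.adj_last w, ?_, ?_⟩
  · rw [Walk.cons_isCycle_iff]
    constructor
    · rw [Walk.isPath_def, hw]
      refine List.Nodup.map_on ?_ List.nodup_range
      intro i hi j hj
      exact hq.inj i (by simpa using hi) j (by simpa using hj)
    · rw [hw']
      simp only [List.mem_map, List.mem_range, Sym2.eq_iff, not_exists, not_and, not_or]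
      intro i hi
      have i1 := hq.inj i (by omega) (#s - 1) (by omega)
      have i2 := hq.inj i (by omega) 0 (by omega)
      have i3 := hq.inj (i + 1) (by omega) (#s - 1) (by omega)
      have i4 := hq.inj (i + 1) (by omega) 0 (by omega)
      refine ⟨fun h _ => ?_, fun h h' => ?_⟩
      · have := i1 h
        omega
      · have := i2 h
        have := i3 h'
        omega
  · intro x
    rw [Walk.support_cons, List.mem_cons, hsupp]
    refine ⟨?_, Or.inr⟩
    rintro (rfl | h)
    · exact hq.mem _ (by omega)
    · exact h

theorem SimpleGraph.Walk.mem_tail_support_of_not_nil {v x : V} {c : G.Walk v v} (hc : ¬c.Nil)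
    (hx : x ∈ c.support) : x ∈ c.support.tail := by
  rw [← Walk.cons_tail_support, List.mem_cons] at hx
  rcases hx with rfl | hx
  · exact Walk.end_mem_tail_support hc
  · exact hx

theorem isCycleOn_of_isCycle [DecidableEq V] {v : V} {c : G.Walk v v} (hc : c.IsCycle) :
    IsCycleOn G c.support.toFinset c.getVert := by
  have hcard : #c.support.toFinset = c.length := by
    have : c.support.toFinset = c.support.tail.toFinset := by
      ext x
      rw [List.mem_toFinset, List.mem_toFinset]
      exact ⟨Walk.mem_tail_support_of_not_nil hc.not_nil, List.mem_of_mem_tail⟩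
    rw [this, List.toFinset_card_of_nodup hc.support_nodup, List.length_tail,
      Walk.length_support, Nat.add_sub_cancel]
  have h3 := hc.three_le_length
  refine ⟨⟨?_, ?_, ?_⟩, by omega, ?_⟩
  · intro i _
    rw [List.mem_toFinset]
    exact Walk.getVert_mem_support c i
  · intro i hi j hj h
    rw [hcard] at hi hj
    exact hc.getVert_injOn' (by simp only [Set.mem_ofPred_eq]; omega)
      (by simp only [Set.mem_ofPred_eq]; omega) h
  · intro i hi
    exact c.adj_getVert_succ (by omega)
  · have := c.adj_getVert_succ (i := c.length - 1) (by omega)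
    rw [show c.length - 1 + 1 = c.length by omega, Walk.getVert_length] at this
    rwa [hcard, Walk.getVert_zero]

variable [Fintype V]

theorem degree_eq_degreeOn_univ (G : SimpleGraph V) (x : V) [Fintype (G.neighborSet x)] :
    G.degree x = degreeOn G univ x := by
  rw [← card_neighborFinset_eq_degree, degreeOn]
  congr 1
  ext y
  simp

theorem IsWeakClosure.le (h : IsWeakClosure G H) : G ≤ H := by
  obtain ⟨h, -⟩ := h
  induction h with
  | refl => exact le_rfl
  | tail _ hs ih =>
    obtain ⟨x, y, -, -, -, rfl⟩ := hs
    exact ih.trans le_sup_left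

variable [DecidableEq V]

theorem isHForceSet_iff {X : Finset V} : IsHForceSet G X ↔
    X.Nonempty ∧ ∀ s, HasCycleOn G s → X ⊆ s → s = univ := by
  refine and_congr_right fun _ => ⟨fun h s hs hX => ?_, fun h v c hc hX => ?_⟩
  · obtain ⟨v, c, hc, hcs⟩ := hs.exists_isCycle
    have := h v c hc fun x hx => (hcs x).2 (hX hx)
    exact eq_univ_iff_forall.2 fun x => (hcs x).1 (this.mem_support x)
  · have := h _ ⟨_, isCycleOn_of_isCycle hc⟩ fun x hx => List.mem_toFinset.2 (hX x hx)
    rw [Walk.isHamiltonianCycle_iff_isCycle_and_support_count_tail_eq_one]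
    refine ⟨hc, fun x => List.count_eq_one_of_mem hc.support_nodup ?_⟩
    exact Walk.mem_tail_support_of_not_nil hc.not_nil
      (List.mem_toFinset.1 (this ▸ mem_univ x))

theorem IsHForceSet.mem_of_hasCycleOn_erase {X : Finset V} (hX : IsHForceSet G X) {v : V}
    (hv : HasCycleOn G (univ.erase v)) : v ∈ X := by
  by_contra h
  have := (isHForceSet_iff.1 hX).2 _ hv fun x hx =>
    mem_erase.2 ⟨fun hxv => h (hxv ▸ hx), mem_univ x⟩
  exact notMem_erase v univ (this.symm ▸ mem_univ v)

theorem hForce_eq {X : Finset V} {k : ℕ} (hX : IsHForceSet G X) (hk : #X = k)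
    (h : ∀ Y, IsHForceSet G Y → k ≤ #Y) : hForce G = k := by
  refine le_antisymm (Nat.sInf_le ⟨X, hX, hk⟩) (le_csInf ⟨k, X, hX, hk⟩ ?_)
  rintro _ ⟨Y, hY, rfl⟩
  exact h Y hY

theorem hForce_eq_card [Nonempty V] (h : ∀ v, HasCycleOn G (univ.erase v)) :
    hForce G = Fintype.card V := by
  refine hForce_eq (X := univ) ?_ card_univ fun Y hY => ?_
  · rw [isHForceSet_iff]
    exact ⟨univ_nonempty, fun s _ hs => univ_subset_iff.1 hs⟩
  · rw [← card_univ]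
    exact card_le_card fun v _ => hY.mem_of_hasCycleOn_erase (h v)

theorem WeakStep.hasCycleOn_erase (h : WeakStep G H) {v : V}
    (hc : HasCycleOn H (univ.erase v)) : HasCycleOn G (univ.erase v) := by
  obtain ⟨x, y, -, -, hd, rfl⟩ := h
  refine hc.of_sup_edge fun _ _ => ?_
  rw [card_erase_of_mem (mem_univ v), card_univ]
  rw [degree_eq_degreeOn_univ, degree_eq_degreeOn_univ] at hd
  have := degreeOn_le_erase_add_one G univ x v
  have := degreeOn_le_erase_add_one G univ y v
  omega

theorem IsWeakClosure.hasCycleOn_erase (h : IsWeakClosure G H) {v : V}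
    (hc : HasCycleOn H (univ.erase v)) : HasCycleOn G (univ.erase v) := by
  obtain ⟨h, -⟩ := h
  induction h with
  | refl => exact hc
  | tail _ hs ih => exact ih (hs.hasCycleOn_erase hc)

end HForce

section TwoCut

variable {V : Type*} {G H : SimpleGraph V}

theorem IsOTG.le_degreeOn [Fintype V] (h : IsOTG G) {x y : V} (hxy : x ≠ y) (hn : ¬G.Adj x y) :
    #(univ : Finset V) ≤ degreeOn G univ x + degreeOn G univ y := by
  have := h x y hxy hn
  rwa [degree_eq_degreeOn_univ, degree_eq_degreeOn_univ] at this

/-- Deleting the two vertices of `T` separates the nonempty sets `A` and `B`. -/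
structure IsTwoCut (G : SimpleGraph V) (T A B : Finset V) : Prop where
  cover : ∀ x, x ∈ T ∨ x ∈ A ∨ x ∈ B
  disjoint_left : Disjoint T A
  disjoint_right : Disjoint T B
  disjoint : Disjoint A B
  card_eq : #T = 2
  nonempty_left : A.Nonempty
  nonempty_right : B.Nonempty
  not_adj : ∀ x ∈ A, ∀ y ∈ B, ¬G.Adj x y

namespace IsTwoCut

variable {T A B : Finset V}

theorem symm (h : IsTwoCut G T A B) : IsTwoCut G T B A where
  cover x := by have := h.cover x; tauto
  disjoint_left := h.disjoint_right
  disjoint_right := h.disjoint_left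
  disjoint := h.disjoint.symm
  card_eq := h.card_eq
  nonempty_left := h.nonempty_right
  nonempty_right := h.nonempty_left
  not_adj x hx y hy := fun hxy => h.not_adj y hy x hx hxy.symm

theorem mono (h : IsTwoCut H T A B) (hGH : G ≤ H) : IsTwoCut G T A B :=
  { h with not_adj := fun x hx y hy hxy => h.not_adj x hx y hy (hGH hxy) }

variable [DecidableEq V]

theorem subset_of_hasCycleOn (h : IsTwoCut G T A B) {s : Finset V} (hs : HasCycleOn G s)
    (hA : A ⊆ s) (hB : B ⊆ s) : T ⊆ s := by
  intro t ht
  by_contra hts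
  obtain ⟨t', ht'⟩ : ∃ t', T.erase t = {t'} := by
    rw [← card_eq_one, card_erase_of_mem ht, h.card_eq]
  obtain ⟨q, hq, hq0⟩ : ∃ q, IsCycleOn G s q ∧ ∀ i, 1 ≤ i → i < #s → q i ≠ t' := by
    obtain ⟨q, hq⟩ := hs
    by_cases hs' : t' ∈ s
    · obtain ⟨a, ha, rfl⟩ := hq.exists_eq hs'
      refine ⟨_, hq.rotate ha, fun i hi his hi' => ?_⟩
      have := (hq.rotate ha).inj i his 0 (by omega) (by simpa [ha] using hi')
      omega
    · exact ⟨q, hq, fun i _ hi hi' => hs' (hi' ▸ hq.mem i hi)⟩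
  have hside : ∀ i < #s, q i = t' ∨ q i ∈ A ∨ q i ∈ B := by
    intro i hi
    rcases h.cover (q i) with hT | hAB
    · have : q i ∈ T.erase t := mem_erase.2 ⟨fun hit => hts (hit ▸ hq.mem i hi), hT⟩
      rw [ht', mem_singleton] at this
      exact .inl this
    · exact .inr hAB
  have hiff : ∀ {x y}, (x ∈ A ∨ x ∈ B) → (y ∈ A ∨ y ∈ B) → G.Adj x y → (x ∈ A ↔ y ∈ A) := by
    intro x y hx hy hxy
    have h1 := h.not_adj x
    have h2 := h.not_adj y
    have h3 := hxy.symm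
    constructor
    · intro hxA
      exact hy.resolve_right fun hyB => h1 hxA y hyB hxy
    · intro hyA
      exact hx.resolve_right fun hxB => h2 hyA x hxB h3
  have h3 := hq.three_le
  have hind : ∀ i, i + 1 < #s → (q (i + 1) ∈ A ↔ q 1 ∈ A) := by
    intro i
    induction i with
    | zero => simp
    | succ i ih =>
      intro hi
      rw [← ih (by omega)]
      exact (hiff ((hside _ (by omega)).resolve_left (hq0 _ (by omega) (by omega)))
        ((hside _ (by omega)).resolve_left (hq0 _ (by omega) (by omega)))
        (hq.adj _ hi)).symm
  have hall : ∀ x ∈ s, x ≠ t' → (x ∈ A ↔ q 1 ∈ A) := by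
    intro x hx hxt
    obtain ⟨i, hi, rfl⟩ := hq.exists_eq hx
    rcases i with _ | i
    · exact hiff ((hside _ hi).resolve_left hxt)
        ((hside _ (by omega)).resolve_left (hq0 _ le_rfl (by omega))) (hq.adj 0 (by omega))
    · exact hind i hi
  have ht'T : t' ∈ T := mem_of_mem_erase (ht' ▸ mem_singleton_self t')
  obtain ⟨a, ha⟩ := h.nonempty_left
  obtain ⟨b, hb⟩ := h.nonempty_right
  have e1 := hall a (hA ha) fun e => Finset.disjoint_left.1 h.disjoint_left ht'T (e ▸ ha)
  have e2 := hall b (hB hb) fun e => Finset.disjoint_left.1 h.disjoint_right ht'T (e ▸ hb)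
  exact Finset.disjoint_left.1 h.disjoint (e2.2 (e1.1 ha)) hb

theorem of_iso {a b : ℕ} (ha : 1 ≤ a) (hb : 1 ≤ b)
    (e : G ≃g graphJoin (⊤ : SimpleGraph (Fin 2))
      ((⊤ : SimpleGraph (Fin a)) ⊕g (⊤ : SimpleGraph (Fin b)))) :
    ∃ T A B, IsTwoCut G T A B := by
  have key : ∀ {α : Type} [Fintype α] (f : α → Fin 2 ⊕ (Fin a ⊕ Fin b)) (x : V),
      x ∈ univ.image (fun i => e.symm (f i)) ↔ ∃ i, f i = e x := by
    intro α _ f x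
    simp only [mem_image, mem_univ, true_and]
    refine exists_congr fun i => ?_
    rw [← e.injective.eq_iff, RelIso.apply_symm_apply]
  refine ⟨univ.image fun i => e.symm (.inl i), univ.image fun i => e.symm (.inr (.inl i)),
    univ.image fun i => e.symm (.inr (.inr i)), ?_, ?_, ?_, ?_, ?_, ?_, ?_, ?_⟩
  · intro x
    rw [key, key fun i : Fin a => .inr (.inl i), key fun i : Fin b => .inr (.inr i)]
    rcases e x with i | i | i
    · exact .inl ⟨i, rfl⟩
    · exact .inr (.inl ⟨i, rfl⟩)
    · exact .inr (.inr ⟨i, rfl⟩)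
  · rw [Finset.disjoint_left]
    intro x
    rw [key, key fun i : Fin a => .inr (.inl i)]
    rintro ⟨i, hi⟩ ⟨j, hj⟩
    simp [← hi] at hj
  · rw [Finset.disjoint_left]
    intro x
    rw [key, key fun i : Fin b => .inr (.inr i)]
    rintro ⟨i, hi⟩ ⟨j, hj⟩
    simp [← hi] at hj
  · rw [Finset.disjoint_left]
    intro x
    rw [key fun i : Fin a => .inr (.inl i), key fun i : Fin b => .inr (.inr i)]
    rintro ⟨i, hi⟩ ⟨j, hj⟩
    simp [← hi] at hj
  · rw [card_image_of_injective, card_univ, Fintype.card_fin]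
    exact e.symm.injective.comp Sum.inl_injective
  · exact ⟨_, mem_image_of_mem _ (mem_univ ⟨0, ha⟩)⟩
  · exact ⟨_, mem_image_of_mem _ (mem_univ ⟨0, hb⟩)⟩
  · intro x hx y hy hxy
    obtain ⟨i, -, rfl⟩ := mem_image.1 hx
    obtain ⟨j, -, rfl⟩ := mem_image.1 hy
    rw [e.symm.map_adj_iff] at hxy
    simp [graphJoin] at hxy

variable [Fintype V]

theorem card_univ_eq (h : IsTwoCut G T A B) : #(univ : Finset V) = 2 + (#A + #B) := by
  rw [← h.card_eq, ← card_union_of_disjoint h.disjoint, ← card_union_of_disjoint]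
  · congr 1
    ext x
    simpa using h.cover x
  · rw [disjoint_union_right]
    exact ⟨h.disjoint_left, h.disjoint_right⟩

theorem degreeOn_le (h : IsTwoCut G T A B) {x : V} (hx : x ∈ A) :
    degreeOn G univ x ≤ #A + 1 := by
  have hsub : ({y ∈ univ | G.Adj x y} : Finset V) ⊆ (A ∪ T).erase x := by
    intro y hy
    have hxy := (mem_filter.1 hy).2
    have := h.not_adj x hx y
    have := h.cover y
    simp only [mem_erase, mem_union]
    exact ⟨hxy.ne', by tauto⟩
  have := card_le_card hsub
  rw [card_erase_of_mem (mem_union_left _ hx),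
    card_union_of_disjoint h.disjoint_left.symm, h.card_eq] at this
  rw [degreeOn]
  omega

theorem adj_left (h : IsTwoCut G T A B) (hG : IsOTG G) {x y : V} (hx : x ∈ A) (hy : y ∉ B)
    (hxy : y ≠ x) : G.Adj x y := by
  by_contra hna
  obtain ⟨b, hb⟩ := h.nonempty_right
  have hsub : ({y ∈ univ | G.Adj x y} : Finset V) ⊆ ((A ∪ T).erase x).erase y := by
    intro z hz
    have hxz := (mem_filter.1 hz).2
    have := h.not_adj x hx z
    have := h.cover z
    simp only [mem_erase, mem_union]
    exact ⟨fun hzy => hna (hzy ▸ hxz), hxz.ne', by tauto⟩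
  have hle := card_le_card hsub
  have hy' : y ∈ A ∪ T := by
    have := h.cover y
    rw [mem_union]
    tauto
  rw [card_erase_of_mem (mem_erase.2 ⟨hxy, hy'⟩), card_erase_of_mem (mem_union_left _ hx),
    card_union_of_disjoint h.disjoint_left.symm, h.card_eq] at hle
  have hb' := h.symm.degreeOn_le hb
  have hsum := hG.le_degreeOn (x := x) (y := b)
    (fun hxb => Finset.disjoint_left.1 h.disjoint hx (hxb ▸ hb)) (h.not_adj x hx b hb)
  rw [h.card_univ_eq] at hsum
  have := card_pos.2 ⟨x, hx⟩
  have : degreeOn G univ x = #{y ∈ univ | G.Adj x y} := rfl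
  omega

theorem le_degreeOn (h : IsTwoCut G T A B) (hG : IsOTG G) {x : V} (hx : x ∈ T) :
    #A + #B ≤ degreeOn G univ x := by
  have hsub : A ∪ B ⊆ ({y ∈ univ | G.Adj x y} : Finset V) := by
    intro y hy
    rw [mem_filter]
    refine ⟨mem_univ y, ?_⟩
    rcases mem_union.1 hy with hy | hy
    · exact (h.adj_left hG hy (Finset.disjoint_left.1 h.disjoint_right hx)
        fun e => Finset.disjoint_left.1 h.disjoint_left hx (e ▸ hy)).symm
    · exact (h.symm.adj_left hG hy (Finset.disjoint_left.1 h.disjoint_left hx)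
        fun e => Finset.disjoint_left.1 h.disjoint_right hx (e ▸ hy)).symm
  rw [← card_union_of_disjoint h.disjoint]
  exact card_le_card hsub

theorem hasCycleOn_erase (h : IsTwoCut G T A B) (hG : IsOTG G) (hn : 5 ≤ Fintype.card V)
    {v : V} (hv : v ∈ A) : HasCycleOn G (univ.erase v) := by
  have hcard := h.card_univ_eq
  have hs : #((univ : Finset V).erase v) = #(univ : Finset V) - 1 := card_erase_of_mem (mem_univ v)
  rw [← card_univ (α := V)] at hn
  have hAB : ∀ x ∈ A, ∀ y ∈ B, #(univ : Finset V) - 1 ≤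
      degreeOn G (univ.erase v) x + degreeOn G (univ.erase v) y := by
    intro x hx y hy
    have := hG.le_degreeOn (x := x) (y := y)
      (fun e => Finset.disjoint_left.1 h.disjoint hx (e ▸ hy))
      (h.not_adj x hx y hy)
    have := degreeOn_le_erase_add_one G univ x v
    have : degreeOn G (univ.erase v) y = degreeOn G univ y := by
      rw [degreeOn, degreeOn]
      congr 1
      ext z
      simp only [mem_filter, mem_erase, mem_univ, and_true, true_and, and_iff_right_iff_imp]
      rintro hyz rfl
      exact h.not_adj z hv y hy hyz.symm
    omega
  refine hasCycleOn_of_ore (by omega) fun x _ y _ hxy hna => ?_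
  rw [hs]
  by_cases hxA : x ∈ A
  · by_cases hyB : y ∈ B
    · exact hAB x hxA y hyB
    · exact absurd (h.adj_left hG hxA hyB hxy.symm) hna
  by_cases hxB : x ∈ B
  · by_cases hyA : y ∈ A
    · rw [add_comm]
      exact hAB y hyA x hxB
    · exact absurd (h.symm.adj_left hG hxB hyA hxy.symm) hna
  by_cases hyA : y ∈ A
  · exact absurd (h.adj_left hG hyA hxB hxy).symm hna
  by_cases hyB : y ∈ B
  · exact absurd (h.symm.adj_left hG hyB hxA hxy).symm hna
  have hxT : x ∈ T := by have := h.cover x; tauto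
  have hyT : y ∈ T := by have := h.cover y; tauto
  have := h.le_degreeOn hG hxT
  have := h.le_degreeOn hG hyT
  have := degreeOn_le_erase_add_one G univ x v
  have := degreeOn_le_erase_add_one G univ y v
  omega

theorem hForce_eq (h : IsTwoCut G T A B) (hG : IsOTG G) (hn : 5 ≤ Fintype.card V) :
    hForce G = Fintype.card V - 2 := by
  have hcard := h.card_univ_eq
  have hAB := card_union_of_disjoint h.disjoint
  rw [card_univ] at hcard
  refine _root_.hForce_eq (X := A ∪ B) ?_ (by omega) fun Y hY => ?_
  · rw [isHForceSet_iff]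
    refine ⟨h.nonempty_left.mono subset_union_left, fun s hs hX => ?_⟩
    have hA := subset_union_left.trans hX
    have hB := subset_union_right.trans hX
    have hT := h.subset_of_hasCycleOn hs hA hB
    refine eq_univ_iff_forall.2 fun x => ?_
    rcases h.cover x with hx | hx | hx
    exacts [hT hx, hA hx, hB hx]
  · have hsub : A ∪ B ⊆ Y := by
      intro v hv
      rcases mem_union.1 hv with hv | hv
      · exact hY.mem_of_hasCycleOn_erase (h.hasCycleOn_erase hG hn hv)
      · exact hY.mem_of_hasCycleOn_erase (h.symm.hasCycleOn_erase hG hn hv)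
    have := card_le_card hsub
    omega

/-- The isomorphism type of an OTG with a separating pair of universal vertices. -/
theorem nonempty_iso (h : IsTwoCut G T A B) (hG : IsOTG G) (hT : ∀ x ∈ T, ∀ y, y ≠ x → G.Adj x y) :
    Nonempty (G ≃g graphJoin (⊤ : SimpleGraph (Fin 2))
      ((⊤ : SimpleGraph (Fin #A)) ⊕g (⊤ : SimpleGraph (Fin #B)))) := by
  let fT := (T.equivFinOfCardEq h.card_eq).symm
  let fA := A.equivFin.symm
  let fB := B.equivFin.symm
  let f : Fin 2 ⊕ (Fin #A ⊕ Fin #B) → V :=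
    Sum.elim (fun i => fT i) (Sum.elim (fun i => fA i) (fun i => fB i))
  have neTA : ∀ i j, (fT i : V) ≠ fA j := fun i j e =>
    Finset.disjoint_left.1 h.disjoint_left (fT i).2 (e ▸ (fA j).2)
  have neTB : ∀ i j, (fT i : V) ≠ fB j := fun i j e =>
    Finset.disjoint_left.1 h.disjoint_right (fT i).2 (e ▸ (fB j).2)
  have neAB : ∀ i j, (fA i : V) ≠ fB j := fun i j e =>
    Finset.disjoint_left.1 h.disjoint (fA i).2 (e ▸ (fB j).2)
  have hinj : Function.Injective f := by
    rintro (i | i | i) (j | j | j) hij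
    · simpa [f, Subtype.val_inj] using hij
    · exact absurd hij (neTA i j)
    · exact absurd hij (neTB i j)
    · exact absurd hij.symm (neTA j i)
    · simpa [f, Subtype.val_inj] using hij
    · exact absurd hij (neAB i j)
    · exact absurd hij.symm (neTB j i)
    · exact absurd hij.symm (neAB j i)
    · simpa [f, Subtype.val_inj] using hij
  have hbij : Function.Bijective f := by
    rw [Fintype.bijective_iff_injective_and_card]
    refine ⟨hinj, ?_⟩
    rw [← card_univ (α := V), h.card_univ_eq]
    simp
  refine ⟨(RelIso.mk (Equiv.ofBijective f hbij) ?_).symm⟩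
  have adjT : ∀ i y, y ≠ (fT i : V) → G.Adj (fT i) y := fun i => hT _ (fT i).2
  have nadj : ∀ i j, ¬G.Adj (fA i : V) (fB j) := fun i j => h.not_adj _ (fA i).2 _ (fB j).2
  rintro (i | i | i) (j | j | j) <;> simp [graphJoin, f]
  · exact ⟨fun hij e => hij.ne (by rw [e]), fun hij => adjT i _ (by simpa [eq_comm] using hij)⟩
  · exact adjT i _ (neTA i j).symm
  · exact adjT i _ (neTB i j).symm
  · exact (adjT j _ (neTA j i).symm).symm
  · exact ⟨fun hij e => hij.ne (by rw [e]), fun hij => h.adj_left hG (fA i).2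
      (Finset.disjoint_left.1 h.disjoint (fA j).2) (by simpa [eq_comm] using hij)⟩
  · exact nadj i j
  · exact (adjT j _ (neTB j i).symm).symm
  · exact fun hij => nadj j i hij.symm
  · exact ⟨fun hij e => hij.ne (by rw [e]), fun hij => h.symm.adj_left hG (fB i).2
      (Finset.disjoint_right.1 h.disjoint (fB j).2) (by simpa [eq_comm] using hij)⟩

end IsTwoCut

end TwoCut

section Balanced

variable {V : Type*} {G : SimpleGraph V} [DecidableEq V]

theorem card_le_card_sdiff_of_hasCycleOn {s I : Finset V} (hs : HasCycleOn G s) (hIs : I ⊆ s)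
    (hI : ∀ x ∈ I, ∀ y ∈ I, ¬G.Adj x y) : #I ≤ #(s \ I) := by
  obtain ⟨q, hq⟩ := hs
  have h3 := hq.three_le
  let J := {i ∈ range #s | q i ∈ I}
  have hIJ : I ⊆ J.image q := by
    intro x hx
    obtain ⟨i, hi, rfl⟩ := hq.exists_eq (hIs hx)
    exact mem_image_of_mem q (mem_filter.2 ⟨mem_range.2 hi, hx⟩)
  refine (card_le_card hIJ).trans (card_image_le.trans ?_)
  refine card_le_card_of_injOn (fun i => q (if i + 1 < #s then i + 1 else 0)) ?_ ?_
  · intro i hi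
    obtain ⟨hi, hiI⟩ := mem_filter.1 (mem_coe.1 hi)
    rw [mem_range] at hi
    have hadj : G.Adj (q i) (q (if i + 1 < #s then i + 1 else 0)) := by
      split_ifs with h
      · exact hq.adj i h
      · obtain rfl : i = #s - 1 := by omega
        exact hq.adj_last
    rw [mem_coe, mem_sdiff]
    exact ⟨hq.mem _ (by split_ifs <;> omega), fun h => hI _ hiI _ h hadj⟩
  · intro i hi j hj hij
    have hi' := mem_range.1 (mem_filter.1 (mem_coe.1 hi)).1
    have hj' := mem_range.1 (mem_filter.1 (mem_coe.1 hj)).1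
    have := hq.inj _ (by split_ifs <;> omega) _ (by split_ifs <;> omega) hij
    split_ifs at this <;> omega

theorem exists_indep_of_iso {k : ℕ} {K : SimpleGraph (Fin k ⊕ Fin k)} (e : G ≃g K)
    (hK : ∀ i j, ¬K.Adj (.inr i) (.inr j)) :
    ∃ I : Finset V, #I = k ∧ ∀ x ∈ I, ∀ y ∈ I, ¬G.Adj x y := by
  refine ⟨univ.image fun i => e.symm (.inr i), ?_, ?_⟩
  · rw [card_image_of_injective, card_univ, Fintype.card_fin]
    exact e.symm.injective.comp Sum.inr_injective
  · intro x hx y hy hxy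
    obtain ⟨i, -, rfl⟩ := mem_image.1 hx
    obtain ⟨j, -, rfl⟩ := mem_image.1 hy
    rw [e.symm.map_adj_iff] at hxy
    exact hK i j hxy

variable [Fintype V] {I : Finset V}

theorem IsOTG.adj_of_indep (hG : IsOTG G) (h2 : 2 ≤ #I)
    (hcard : Fintype.card V = 2 * #I) (hI : ∀ x ∈ I, ∀ y ∈ I, ¬G.Adj x y) {x y : V}
    (hx : x ∈ I) (hy : y ∉ I) : G.Adj x y := by
  have hle : ∀ z ∈ I, ({w ∈ univ | G.Adj z w} : Finset V) ⊆ Iᶜ := fun z hz w hw =>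
    mem_compl.2 fun hwI => hI z hz w hwI (mem_filter.1 hw).2
  have hC := card_compl I
  obtain ⟨x', hx', hne⟩ := exists_mem_ne h2 x
  have h1 := hG.le_degreeOn hne.symm (hI x hx x' hx')
  have hx'le := card_le_card (hle x' hx')
  rw [card_univ, degreeOn, degreeOn] at h1
  have := eq_of_subset_of_card_le (hle x hx) (by omega)
  have hy' : y ∈ ({w ∈ univ | G.Adj x w} : Finset V) := by rw [this]; exact mem_compl.2 hy
  exact (mem_filter.1 hy').2

theorem hasCycleOn_erase_erase (h3 : 3 ≤ #I) (hcard : Fintype.card V = 2 * #I)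
    (hadj : ∀ x ∈ I, ∀ y ∉ I, G.Adj x y) {x y : V} (hx : x ∈ I) (hy : y ∉ I) :
    HasCycleOn G ((univ.erase x).erase y) := by
  have hC := card_compl I
  have hs : #((univ.erase x).erase y) = 2 * #I - 2 := by
    rw [card_erase_of_mem (mem_erase.2 ⟨(ne_of_mem_of_not_mem hx hy).symm, mem_univ y⟩),
      card_erase_of_mem (mem_univ x), card_univ]
    omega
  have hd : ∀ z, #I - 1 ≤ degreeOn G ((univ.erase x).erase y) z := by
    intro z
    by_cases hz : z ∈ I
    · have hsub : Iᶜ.erase y ⊆ {w ∈ (univ.erase x).erase y | G.Adj z w} := by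
        intro w hw
        simp only [mem_erase, mem_compl] at hw
        simp only [mem_filter, mem_erase, mem_univ, and_true]
        exact ⟨⟨hw.1, fun e => hw.2 (e ▸ hx)⟩, hadj z hz w hw.2⟩
      have := card_le_card hsub
      rw [card_erase_of_mem (mem_compl.2 hy)] at this
      rw [degreeOn]
      omega
    · have hsub : I.erase x ⊆ {w ∈ (univ.erase x).erase y | G.Adj z w} := by
        intro w hw
        simp only [mem_erase] at hw
        simp only [mem_filter, mem_erase, mem_univ, and_true]
        exact ⟨⟨fun e => hy (e ▸ hw.2), hw.1⟩, (hadj w hw.2 z hz).symm⟩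
      have := card_le_card hsub
      rwa [card_erase_of_mem hx] at this
  refine hasCycleOn_of_ore (by omega) fun z _ w _ _ _ => ?_
  have := hd z
  have := hd w
  omega

theorem IsOTG.hForce_eq_of_indep (hG : IsOTG G) (h3 : 3 ≤ #I)
    (hcard : Fintype.card V = 2 * #I) (hI : ∀ x ∈ I, ∀ y ∈ I, ¬G.Adj x y) :
    hForce G = #I := by
  have hadj : ∀ x ∈ I, ∀ y ∉ I, G.Adj x y := fun x hx y hy =>
    hG.adj_of_indep (by omega) hcard hI hx hy
  refine hForce_eq (X := I) ?_ rfl fun Y hY => ?_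
  · rw [isHForceSet_iff]
    refine ⟨card_pos.1 (by omega), fun s hs hIs => ?_⟩
    have h1 := card_le_card_sdiff_of_hasCycleOn hs hIs hI
    have h2 := card_sdiff_add_card_eq_card hIs
    rw [← card_eq_iff_eq_univ]
    have := card_le_univ s
    omega
  · by_cases hIY : I ⊆ Y
    · exact card_le_card hIY
    obtain ⟨x, hx, hxY⟩ := not_subset.1 hIY
    have hC := card_compl I
    have hsub : Iᶜ ⊆ Y := by
      intro y hy
      by_contra hyY
      have h1 := (isHForceSet_iff.1 hY).2 _
        (hasCycleOn_erase_erase h3 hcard hadj hx (mem_compl.1 hy)) fun z hz =>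
          mem_erase.2 ⟨fun e => hyY (e ▸ hz), mem_erase.2 ⟨fun e => hxY (e ▸ hz), mem_univ z⟩⟩
      exact notMem_erase y (univ.erase x) (h1.symm ▸ mem_univ y)
    have := card_le_card hsub
    omega

theorem nonempty_iso_completeBipartiteGraph {C : Finset V} (hIC : IsCompl I C)
    (hI : ∀ x ∈ I, ∀ y ∈ I, ¬G.Adj x y) (hC : ∀ x ∈ C, ∀ y ∈ C, ¬G.Adj x y)
    (hadj : ∀ x ∈ I, ∀ y ∈ C, G.Adj x y) :
    Nonempty (G ≃g completeBipartiteGraph (Fin #I) (Fin #C)) := by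
  let fI := I.equivFin.symm
  let fC := C.equivFin.symm
  let f : Fin #I ⊕ Fin #C → V := Sum.elim (fun i => fI i) (fun i => fC i)
  have ne : ∀ i j, (fI i : V) ≠ fC j := fun i j e =>
    Finset.disjoint_left.1 hIC.disjoint (fI i).2 (e ▸ (fC j).2)
  have hinj : Function.Injective f := by
    rintro (i | i) (j | j) hij
    · simpa [f, Subtype.val_inj] using hij
    · exact absurd hij (ne i j)
    · exact absurd hij.symm (ne j i)
    · simpa [f, Subtype.val_inj] using hij
  have hsurj : Function.Surjective f := by
    intro x
    have hx : x ∈ I ⊔ C := by rw [hIC.sup_eq_top]; exact mem_univ x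
    rcases mem_union.1 hx with hx | hx
    · exact ⟨.inl (I.equivFin ⟨x, hx⟩), by simp [f, fI]⟩
    · exact ⟨.inr (C.equivFin ⟨x, hx⟩), by simp [f, fC]⟩
  refine ⟨(RelIso.mk (Equiv.ofBijective f ⟨hinj, hsurj⟩) ?_).symm⟩
  rintro (i | i) (j | j) <;> simp [f]
  · exact hI _ (fI i).2 _ (fI j).2
  · exact hadj _ (fI i).2 _ (fC j).2
  · exact (hadj _ (fI j).2 _ (fC i).2).symm
  · exact hC _ (fC i).2 _ (fC j).2

end Balanced

namespace IsZJoinK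

variable {V : Type*} {G : SimpleGraph V} [Fintype V] [DecidableEq V] {m k : ℕ}

theorem isOTG (h : IsZJoinK G m) : IsOTG G := by
  obtain ⟨S, -, hS, hd⟩ := h
  intro x y hxy hna
  have := hd x fun hx => hna (hS x hx y hxy.symm)
  have := hd y fun hy => hna (hS y hy x hxy).symm
  omega

theorem le_degreeOn (h : IsZJoinK G m) (hn : 5 ≤ Fintype.card V) (hk : Fintype.card V = 2 * k)
    (x : V) : k ≤ degreeOn G univ x := by
  obtain ⟨S, -, hS, hd⟩ := h
  by_cases hx : x ∈ S
  · have hsub : univ.erase x ⊆ ({y ∈ univ | G.Adj x y} : Finset V) := fun y hy =>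
      mem_filter.2 ⟨mem_univ y, hS x hx y (ne_of_mem_erase hy)⟩
    have := card_le_card hsub
    rw [card_erase_of_mem (mem_univ x), card_univ] at this
    rw [degreeOn]
    omega
  · have := hd x hx
    rw [degree_eq_degreeOn_univ] at this
    omega

theorem nonempty_iso_of_indep (h : IsZJoinK G m) (hm : m < k) (hk : Fintype.card V = 2 * k)
    (h2 : 2 ≤ k) {I : Finset V} (hIk : #I = k) (hI : ∀ x ∈ I, ∀ y ∈ I, ¬G.Adj x y) :
    Nonempty (G ≃g completeBipartiteGraph (Fin k) (Fin k)) := by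
  have hadj : ∀ x ∈ I, ∀ y ∉ I, G.Adj x y := fun x hx y hy =>
    h.isOTG.adj_of_indep (by omega) (by omega) hI hx hy
  obtain ⟨S, hSm, hS, hd⟩ := h
  have hCk : #Iᶜ = k := by
    rw [card_compl]
    omega
  have hC : ∀ c ∉ I, c ∉ S → ∀ c' ∉ I, ¬G.Adj c c' := by
    intro c hc hcS c' hc' hcc'
    have hsub : I ⊆ ({y ∈ univ | G.Adj c y} : Finset V) := fun y hy =>
      mem_filter.2 ⟨mem_univ y, (hadj y hy c hc).symm⟩
    have hdc := hd c hcS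
    rw [degree_eq_degreeOn_univ, degreeOn] at hdc
    have := eq_of_subset_of_card_le hsub (by omega)
    rw [this] at hc'
    exact hc' (mem_filter.2 ⟨mem_univ c', hcc'⟩)
  obtain ⟨c, hc, hcS⟩ : ∃ c ∈ Iᶜ, c ∉ S := exists_mem_notMem_of_card_lt_card (by omega)
  rw [mem_compl] at hc
  have hCS : ∀ c' ∉ I, c' ∉ S := by
    intro c' hc' hc'S
    have hne : c ≠ c' := fun e => hcS (e ▸ hc'S)
    exact hC c hc hcS c' hc' (hS c' hc'S c hne).symm
  have := nonempty_iso_completeBipartiteGraph (I := I) (C := Iᶜ) isCompl_compl hI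
    (fun x hx y hy => hC x (mem_compl.1 hx) (hCS x (mem_compl.1 hx)) y (mem_compl.1 hy))
    (fun x hx y hy => hadj x hx y (mem_compl.1 hy))
  rwa [hIk, hCk] at this

theorem nonempty_iso_of_isTwoCut (h : IsZJoinK G m) (hn : 5 ≤ Fintype.card V)
    {T A B : Finset V} (hT : IsTwoCut G T A B) :
    Nonempty (G ≃g graphJoin (⊤ : SimpleGraph (Fin 2))
      ((⊤ : SimpleGraph (Fin #A)) ⊕g (⊤ : SimpleGraph (Fin #B)))) := by
  refine hT.nonempty_iso h.isOTG fun x hx => ?_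
  have hle := hT.le_degreeOn h.isOTG hx
  have hcard := hT.card_univ_eq
  rw [card_univ] at hcard
  obtain ⟨S, -, hS, hd⟩ := h
  refine hS x ?_
  by_contra hxS
  have := hd x hxS
  rw [degree_eq_degreeOn_univ] at this
  omega

theorem hasCycleOn_erase (h : IsZJoinK G m) (hm : m < k) (hn : 5 ≤ Fintype.card V)
    (hk : Fintype.card V = 2 * k)
    (h1 : ¬Nonempty (G ≃g graphJoin (⊤ : SimpleGraph (Fin 2))
      ((⊤ : SimpleGraph (Fin (k - 1))) ⊕g (⊤ : SimpleGraph (Fin (k - 1))))))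
    (h2 : ¬Nonempty (G ≃g completeBipartiteGraph (Fin k) (Fin k))) (v : V) :
    HasCycleOn G (univ.erase v) := by
  have hd := h.le_degreeOn hn hk
  have hs : #((univ : Finset V).erase v) = 2 * (k - 1) + 1 := by
    rw [card_erase_of_mem (mem_univ v), card_univ]
    omega
  have hC : HasCycleOn G univ := by
    refine hasCycleOn_of_ore (by rw [card_univ]; omega) fun x _ y _ _ _ => ?_
    have := hd x
    have := hd y
    rw [card_univ]
    omega
  obtain ⟨p, hp⟩ := hC.exists_isPathOn_erase (mem_univ v)
  rcases hp.hasCycleOn_or (r := k - 1) (by omega) hs fun x _ => by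
      have := hd x
      have := degreeOn_le_erase_add_one G univ x v
      omega with hc | ⟨I, -, hIk, hI⟩ | ⟨A, B, -, -, hAk, hBk, hAB, hna⟩
  · exact hc
  · exact absurd (h.nonempty_iso_of_indep hm hk (by omega) (by omega) hI) h2
  · refine absurd ?_ h1
    have hT : IsTwoCut G (A ∪ B)ᶜ A B :=
      { cover := fun x => by
          simp only [mem_compl, mem_union]
          tauto
        disjoint_left := disjoint_compl_left.mono_right subset_union_left
        disjoint_right := disjoint_compl_left.mono_right subset_union_right
        disjoint := hAB
        card_eq := by
          rw [card_compl, card_union_of_disjoint hAB]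
          omega
        nonempty_left := card_pos.1 (by omega)
        nonempty_right := card_pos.1 (by omega)
        not_adj := hna }
    have := h.nonempty_iso_of_isTwoCut hn hT
    rwa [hAk, hBk] at this

end IsZJoinK

/-- For an OTG `G` with `n ≥ 5` vertices and weak closure `Gw`: `h(G) = n - 2` if
`Gw ≅ K_2 ∨ (K_m + K_{n-m-2})` with `1 ≤ m < n / 2`; `h(G) = n / 2` if `n` is even and
`Gw ≅ K_{n/2} ∨ K^c_{n/2}` or `Gw ≅ K_{n/2, n/2}`; and `h(G) = n` in the remaining cases:
`Gw` complete, or `Gw = Z_{n-m} ∨ K_m` with `n` even, `0 ≤ m < n / 2`, every vertex of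
`Z_{n-m}` of degree `n / 2` in `Gw`, and `Gw` not isomorphic to
`K_2 ∨ (K_{n/2-1} + K_{n/2-1})` or `K_{n/2, n/2}`. -/
theorem stmt_14 {V : Type*} [Fintype V] [DecidableEq V] (G Gw : SimpleGraph V) (n : ℕ)
    (hcard : Fintype.card V = n) (hn : 5 ≤ n) (hOTG : IsOTG G) (hw : IsWeakClosure G Gw) :
    (∀ m : ℕ, 1 ≤ m → 2 * m < n →
      Nonempty (Gw ≃g graphJoin (⊤ : SimpleGraph (Fin 2))
        ((⊤ : SimpleGraph (Fin m)) ⊕g (⊤ : SimpleGraph (Fin (n - m - 2))))) →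
      hForce G = n - 2) ∧
    (Even n →
      (Nonempty (Gw ≃g graphJoin (⊤ : SimpleGraph (Fin (n / 2)))
          (⊥ : SimpleGraph (Fin (n / 2)))) ∨
       Nonempty (Gw ≃g completeBipartiteGraph (Fin (n / 2)) (Fin (n / 2)))) →
      2 * hForce G = n) ∧
    ((Gw = ⊤ ∨
        (Even n ∧ (∃ m : ℕ, 2 * m < n ∧ IsZJoinK Gw m) ∧
          ¬Nonempty (Gw ≃g graphJoin (⊤ : SimpleGraph (Fin 2))
            ((⊤ : SimpleGraph (Fin (n / 2 - 1))) ⊕g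
              (⊤ : SimpleGraph (Fin (n / 2 - 1))))) ∧
          ¬Nonempty (Gw ≃g completeBipartiteGraph (Fin (n / 2)) (Fin (n / 2))))) →
      hForce G = n) := by
  subst hcard
  refine ⟨?_, ?_, ?_⟩
  · rintro m hm1 hm2 ⟨e⟩
    obtain ⟨T, A, B, h⟩ := IsTwoCut.of_iso hm1 (by omega) e
    exact (h.mono hw.le).hForce_eq hOTG hn
  · rintro ⟨k, hk⟩ he
    have hk' : Fintype.card V / 2 = k := by omega
    rw [hk'] at he
    obtain ⟨I, hIk, hI⟩ : ∃ I : Finset V, #I = k ∧ ∀ x ∈ I, ∀ y ∈ I, ¬Gw.Adj x y := by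
      rcases he with ⟨⟨e⟩⟩ | ⟨⟨e⟩⟩
      · exact exists_indep_of_iso e fun i j => by simp [graphJoin]
      · exact exists_indep_of_iso e fun i j => by simp
    have := hOTG.hForce_eq_of_indep (I := I) (by omega) (by omega)
      fun x hx y hy hxy => hI x hx y hy (hw.le hxy)
    omega
  · intro h
    have : Nonempty V := Fintype.card_pos_iff.1 (by omega)
    refine hForce_eq_card fun v => hw.hasCycleOn_erase ?_
    rcases h with rfl | ⟨⟨k, hk⟩, ⟨m, hm, hZ⟩, h1, h2⟩
    · refine hasCycleOn_of_clique ?_ fun x _ y _ hxy => hxy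
      rw [card_erase_of_mem (mem_univ v), card_univ]
      omega
    · have hk' : Fintype.card V / 2 = k := by omega
      rw [hk'] at h1 h2
      exact hZ.hasCycleOn_erase (by omega) (by omega) (by omega) h1 h2 v
end

section
/- Let G be a simple graph with n ≥ 5 vertices that is not complete, such that d(u) + d(v) = n for every pair of nonadjacent vertices u, v, and such that 2 ≤ δ(G) < n/2. Then G is isomorphic to K_2 ∨ (K_{a−1} + K_{n−a−1}), where a = δ(G); in particular, G has exactly two vertices of degree n − 1. -/
open Finset SimpleGraph
open scoped Classical

/-- The non-neighbours, the neighbours and the vertex itself partition the vertex set. -/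
theorem card_compl_adj_add_degree {V : Type*} [Fintype V] [DecidableEq V] (G : SimpleGraph V)
    (x : V) : #{u | Gᶜ.Adj x u} + G.degree x + 1 = Fintype.card V := by
  have h := G.degree_compl x
  have hlt := G.degree_lt_card_verts x
  have hcard : #{u | Gᶜ.Adj x u} = Gᶜ.degree x := by
    rw [← card_neighborFinset_eq_degree]
    congr 1
    ext u
    simp
  omega

/-- A graph that is partitioned into two cliques without edges between them and a pair of
adjacent dominating vertices is `K_2 ∨ (K_p + K_q)`. -/
theorem nonempty_iso_graphJoin {V : Type*} [Fintype V] (G : SimpleGraph V)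
    {k p q : ℕ} {R X Y : Finset V} (hcard : Fintype.card V = k + (p + q))
    (hR : #R = k) (hX : #X = p) (hY : #Y = q)
    (hRX : ∀ r ∈ R, ∀ x ∈ X, r ≠ x) (hRY : ∀ r ∈ R, ∀ y ∈ Y, r ≠ y)
    (hXY : ∀ x ∈ X, ∀ y ∈ Y, x ≠ y)
    (hdom : ∀ r ∈ R, ∀ v, r ≠ v → G.Adj r v)
    (hXclique : ∀ x ∈ X, ∀ x' ∈ X, x ≠ x' → G.Adj x x')
    (hYclique : ∀ y ∈ Y, ∀ y' ∈ Y, y ≠ y' → G.Adj y y')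
    (hnot : ∀ x ∈ X, ∀ y ∈ Y, ¬G.Adj x y) :
    Nonempty (G ≃g graphJoin (⊤ : SimpleGraph (Fin k))
      ((⊤ : SimpleGraph (Fin p)) ⊕g (⊤ : SimpleGraph (Fin q)))) := by
  let eR := (R.equivFinOfCardEq hR).symm
  let eX := (X.equivFinOfCardEq hX).symm
  let eY := (Y.equivFinOfCardEq hY).symm
  let f : Fin k ⊕ (Fin p ⊕ Fin q) → V :=
    Sum.elim (fun i => eR i) (Sum.elim (fun i => eX i) (fun i => eY i))
  have hf : Function.Injective f :=
    (Subtype.val_injective.comp eR.injective).sumElim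
      ((Subtype.val_injective.comp eX.injective).sumElim
        (Subtype.val_injective.comp eY.injective)
        fun i j => hXY _ (eX i).2 _ (eY j).2)
      (by
        rintro i (j | j)
        · exact hRX _ (eR i).2 _ (eX j).2
        · exact hRY _ (eR i).2 _ (eY j).2)
  have hbij : Function.Bijective f :=
    (Fintype.bijective_iff_injective_and_card f).2 ⟨hf, by simp [hcard]⟩
  have hadj : ∀ s t, G.Adj (f s) (f t) ↔ (graphJoin (⊤ : SimpleGraph (Fin k))
      ((⊤ : SimpleGraph (Fin p)) ⊕g (⊤ : SimpleGraph (Fin q)))).Adj s t := by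
    have hdom' : ∀ i t, G.Adj (f (.inl i)) (f t) ↔ Sum.inl i ≠ t := fun i t =>
      ⟨fun h e => h.ne (congrArg f e), fun h => hdom _ (eR i).2 _ (hf.ne h)⟩
    have hX' : ∀ i j, G.Adj (f (.inr (.inl i))) (f (.inr (.inl j))) ↔ i ≠ j := fun i j =>
      ⟨fun h e => h.ne (by rw [e]), fun h => hXclique _ (eX i).2 _ (eX j).2 fun e =>
        h (eX.injective (Subtype.ext e))⟩
    have hY' : ∀ i j, G.Adj (f (.inr (.inr i))) (f (.inr (.inr j))) ↔ i ≠ j := fun i j =>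
      ⟨fun h e => h.ne (by rw [e]), fun h => hYclique _ (eY i).2 _ (eY j).2 fun e =>
        h (eY.injective (Subtype.ext e))⟩
    have hXY' : ∀ i j, ¬G.Adj (f (.inr (.inl i))) (f (.inr (.inr j))) := fun i j =>
      hnot _ (eX i).2 _ (eY j).2
    rintro (i | i | i) (j | j | j)
    all_goals first
      | rw [hdom']; simp [graphJoin]
      | rw [G.adj_comm, hdom']; simp [graphJoin]
      | rw [hX']; simp [graphJoin]
      | rw [hY']; simp [graphJoin]
      | simp [graphJoin, hXY']; done
      | rw [G.adj_comm]; simp [graphJoin, hXY']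
  exact ⟨(⟨Equiv.ofBijective f hbij, hadj _ _⟩ : _ ≃g G).symm⟩

/-- A non-complete graph with `n ≥ 5` vertices in which every pair of nonadjacent vertices has
degree sum exactly `n` and `2 ≤ δ(G) < n / 2` is isomorphic to `K_2 ∨ (K_{a-1} + K_{n-a-1})`
with `a = δ(G)`; in particular it has exactly two vertices of degree `n - 1`. -/
theorem stmt_15 {V : Type*} [Fintype V] [DecidableEq V] (G : SimpleGraph V) (n : ℕ)
    (hcard : Fintype.card V = n) (hn : 5 ≤ n) (hnotc : G ≠ ⊤)
    (hsum : ∀ u v : V, u ≠ v → ¬G.Adj u v → G.degree u + G.degree v = n)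
    (hδ1 : 2 ≤ G.minDegree) (hδ2 : 2 * G.minDegree < n) :
    Nonempty (G ≃g graphJoin (⊤ : SimpleGraph (Fin 2))
      ((⊤ : SimpleGraph (Fin (G.minDegree - 1))) ⊕g
        (⊤ : SimpleGraph (Fin (n - G.minDegree - 1))))) ∧
    (Finset.univ.filter fun x : V => G.degree x = n - 1).card = 2 := by
  have : Nonempty V := Fintype.card_pos_iff.1 (by omega)
  obtain ⟨v, hv⟩ := G.exists_minimal_degree_vertex
  generalize G.minDegree = a at *
  have hcompl := card_compl_adj_add_degree G
  let X : Finset V := {x | G.degree x = a}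
  let Y : Finset V := {y | G.degree y = n - a}
  let R : Finset V := {r | G.degree r ≠ a ∧ G.degree r ≠ n - a}
  have mX : ∀ x, x ∈ X ↔ G.degree x = a := by simp [X]
  have mY : ∀ y, y ∈ Y ↔ G.degree y = n - a := by simp [Y]
  have mR : ∀ r, r ∈ R ↔ G.degree r ≠ a ∧ G.degree r ≠ n - a := by simp [R]
  have habove : ∀ x ∈ X, bipartiteAbove Gᶜ.Adj Y x = ({u | Gᶜ.Adj x u} : Finset V) := by
    intro x hx
    ext u
    simp only [mem_bipartiteAbove, mem_filter, mem_univ, true_and, and_iff_right_iff_imp]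
    intro h
    have := hsum x u h.ne h.2
    rw [mX] at hx
    rw [mY]
    omega
  have hbelow : ∀ y ∈ Y, bipartiteBelow Gᶜ.Adj X y = ({u | Gᶜ.Adj y u} : Finset V) := by
    intro y hy
    ext u
    simp only [mem_bipartiteBelow, mem_filter, mem_univ, true_and, Gᶜ.adj_comm u y,
      and_iff_right_iff_imp]
    intro h
    have := hsum y u h.ne h.2
    rw [mY] at hy
    rw [mX]
    omega
  have hXdeg : ∀ x ∈ X, #(bipartiteAbove Gᶜ.Adj Y x) = n - a - 1 := by
    intro x hx
    rw [habove x hx]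
    have := hcompl x
    rw [mX] at hx
    omega
  have hYdeg : ∀ y ∈ Y, #(bipartiteBelow Gᶜ.Adj X y) = a - 1 := by
    intro y hy
    rw [hbelow y hy]
    have := hcompl y
    rw [mY] at hy
    omega
  have hYle : n - a - 1 ≤ #Y := by
    rw [← hXdeg v ((mX v).2 hv.symm)]
    exact card_le_card (filter_subset _ _)
  have hXle : a - 1 ≤ #X := by
    obtain ⟨y, hy⟩ : Y.Nonempty := card_pos.1 (by omega)
    rw [← hYdeg y hy]
    exact card_le_card (filter_subset _ _)
  have hmul : #X * (n - a - 1) = #Y * (a - 1) := card_mul_eq_card_mul Gᶜ.Adj hXdeg hYdeg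
  have htotal : #X + #Y + #R = n := by
    have hXY : Disjoint X Y := disjoint_left.2 fun x => by rw [mX, mY]; omega
    have hR : R = (X ∪ Y)ᶜ := by ext r; simp [mR, mX, mY]
    rw [← card_union_of_disjoint hXY, hR, card_add_card_compl, hcard]
  have hsizes : #X = a - 1 ∧ #Y = n - a - 1 := by
    obtain ⟨i, hi⟩ := Nat.exists_eq_add_of_le hXle
    obtain ⟨j, hj⟩ := Nat.exists_eq_add_of_le hYle
    have hij : i * (n - a - 1) = j * (a - 1) := by
      rw [hi, hj] at hmul
      linarith [mul_comm (a - 1) (n - a - 1)]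
    have hle : i + j ≤ 2 := by omega
    have hi2 : i ≤ 2 := by omega
    have hj2 : j ≤ 2 := by omega
    interval_cases i <;> interval_cases j <;> omega
  obtain ⟨hX, hY⟩ := hsizes
  have hR : #R = 2 := by omega
  have hnot : ∀ x ∈ X, ∀ y ∈ Y, ¬G.Adj x y := by
    intro x hx y hy
    have h : bipartiteAbove Gᶜ.Adj Y x = Y :=
      eq_of_subset_of_card_le (filter_subset _ _) (by rw [hXdeg x hx, hY])
    rw [← h, mem_bipartiteAbove] at hy
    exact hy.2.2
  have hdom : ∀ r ∈ R, ∀ u, r ≠ u → G.Adj r u := by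
    intro r hr u hru
    by_contra h
    have hmem : ∀ r ∈ R, ∀ u, r ≠ u → ¬G.Adj r u → u ∈ R := by
      intro r hr u hru h
      have := hsum r u hru h
      have := hcompl r
      rw [mR] at hr ⊢
      omega
    have hdeg : ∀ r ∈ R, n ≤ G.degree r + 2 := by
      intro r hr
      have hsub : ({u | Gᶜ.Adj r u} : Finset V) ⊆ R.erase r := by
        intro u hu
        rw [mem_filter] at hu
        exact mem_erase.2 ⟨hu.2.ne', hmem r hr u hu.2.ne hu.2.2⟩
      have := card_le_card hsub
      rw [card_erase_of_mem hr, hR] at this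
      have := hcompl r
      omega
    have := hdeg r hr
    have := hdeg u (hmem r hr u hru h)
    have := hsum r u hru h
    omega
  refine ⟨nonempty_iso_graphJoin G (R := R) (X := X) (Y := Y) (by omega) hR hX hY ?_ ?_ ?_ hdom
    ?_ ?_ hnot, ?_⟩
  · rintro r hr _ hx rfl
    exact ((mR r).1 hr).1 ((mX r).1 hx)
  · rintro r hr _ hy rfl
    exact ((mR r).1 hr).2 ((mY r).1 hy)
  · rintro x hx _ hy rfl
    rw [mX] at hx
    rw [mY] at hy
    omega
  · intro x hx x' hx' hne
    by_contra h
    have := hsum x x' hne h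
    rw [mX] at hx hx'
    omega
  · intro y hy y' hy' hne
    by_contra h
    have := hsum y y' hne h
    rw [mY] at hy hy'
    omega
  · rw [← hR]
    congr 1
    ext r
    rw [mem_filter, mR]
    refine ⟨fun h => by omega, fun h => ⟨mem_univ _, ?_⟩⟩
    have hempty : ({u | Gᶜ.Adj r u} : Finset V) = ∅ :=
      filter_eq_empty_iff.2 fun u _ hu => hu.2 (hdom r ((mR r).2 h) u hu.ne)
    have := hcompl r
    rw [hempty, card_empty] at this
    omega
end

section
/- Let n ≥ 5 and 1 ≤ m < n/2, and let G = K_2 ∨ (K_m + K_{n−m−2}), with x and y denoting the two vertices of the K_2. Then V(G) \ {x, y} is an H-force set of G of minimum cardinality, and h(G) = n − 2. -/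
open Finset SimpleGraph
open scoped Classical

/-- `X` is an H-force set of `G` of minimum cardinality. -/
def IsMinHForceSet {V : Type*} [Fintype V] [DecidableEq V] (G : SimpleGraph V)
    (X : Finset V) : Prop :=
  IsHForceSet G X ∧ ∀ Y : Finset V, IsHForceSet G Y → X.card ≤ Y.card

/-- A walk that leaves `A`, all of whose outgoing edges end in `x` or `y`, passes through
`x` or `y`. -/
theorem SimpleGraph.Walk.mem_support_or_mem_support_of_separates {V : Type*}
    {G : SimpleGraph V} {A : Set V} {x y a b : V}
    (hA : ∀ u ∈ A, ∀ w, G.Adj u w → w ∈ A ∨ w = x ∨ w = y)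
    (p : G.Walk a b) (ha : a ∈ A) (hb : b ∉ A) : x ∈ p.support ∨ y ∈ p.support := by
  obtain ⟨d, hd, h1, h2⟩ := p.exists_boundary_dart A ha hb
  have hs := p.dart_snd_mem_support_of_mem_darts hd
  rcases hA _ h1 _ d.adj with h | h | h
  · exact absurd h h2
  · exact .inl (h ▸ hs)
  · exact .inr (h ▸ hs)

/-- A cycle meeting both sides of a two-vertex separator `{x, y}` contains `x`. -/
theorem SimpleGraph.Walk.IsCycle.mem_support_of_separates {V : Type*} [DecidableEq V]
    {G : SimpleGraph V} {A : Set V} {x y a b v : V}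
    (hA : ∀ u ∈ A, ∀ w, G.Adj u w → w ∈ A ∨ w = x ∨ w = y)
    {c : G.Walk v v} (hc : c.IsCycle) (ha : a ∈ A) (hb : b ∉ A) (hy : y ∉ A) (hby : b ≠ y)
    (hac : a ∈ c.support) (hbc : b ∈ c.support) : x ∈ c.support := by
  by_contra hx
  have hmem : ∀ w, w ∈ (c.rotate a hac).support ↔ w ∈ c.support := fun w =>
    Walk.mem_support_rotate_iff ..
  have hb' : b ∈ (c.rotate a hac).support := (hmem b).2 hbc
  have hx' : x ∉ (c.rotate a hac).support := fun h => hx ((hmem x).1 h)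
  have hn := (hc.rotate hac).support_nodup
  obtain ⟨p, q, hpq⟩ := Walk.mem_support_iff_exists_append.1 hb'
  rw [hpq, Walk.tail_support_append] at hn
  rw [hpq, Walk.mem_support_append_iff, not_or] at hx'
  have hyp : y ∈ p.support :=
    (p.mem_support_or_mem_support_of_separates hA ha hb).resolve_left hx'.1
  have hyq : y ∈ q.support := by
    have := (q.reverse.mem_support_or_mem_support_of_separates hA ha hb)
    simp only [Walk.support_reverse, List.mem_reverse] at this
    exact this.resolve_left hx'.2
  rw [Walk.mem_support_iff] at hyp hyq
  exact List.disjoint_of_nodup_append hn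
    (hyp.resolve_left fun h => hy (h ▸ ha)) (hyq.resolve_left hby.symm)

theorem SimpleGraph.Walk.IsCycle.isHamiltonianCycle_of_forall_mem_support {V : Type*}
    [DecidableEq V] {G : SimpleGraph V} {v : V} {c : G.Walk v v} (hc : c.IsCycle)
    (h : ∀ w, w ∈ c.support) : c.IsHamiltonianCycle := by
  rw [Walk.isHamiltonianCycle_iff_isCycle_and_support_count_tail_eq_one]
  refine ⟨hc, fun w => List.count_eq_one_of_mem hc.support_nodup ?_⟩
  rcases c.mem_support_iff.1 (h w) with rfl | hw
  · exact Walk.end_mem_tail_support hc.not_nil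
  · exact hw

/-- A closed chain of at least three distinct vertices is the vertex list of a cycle. -/
theorem SimpleGraph.exists_isCycle_of_isChain {V : Type*} {G : SimpleGraph V} {l : List V}
    (hl : l ≠ []) (hchain : l.IsChain G.Adj) (hnodup : l.Nodup) (hlen : 3 ≤ l.length)
    (hclose : G.Adj (l.getLast hl) (l.head hl)) :
    ∃ (v : V) (c : G.Walk v v), c.IsCycle ∧ ∀ w, w ∈ c.support ↔ w ∈ l := by
  have hp : (Walk.ofSupport l hl hchain).IsPath := by
    rw [Walk.isPath_def, Walk.support_ofSupport]; exact hnodup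
  refine ⟨_, .cons hclose (.ofSupport l hl hchain), ?_, fun w => ?_⟩
  · refine (Walk.cons_isCycle_iff ..).2 ⟨hp, fun he => ?_⟩
    have := hp.length_eq_one_of_mem_edges (Sym2.eq_swap ▸ he)
    rw [Walk.length_ofSupport] at this
    omega
  · rw [Walk.support_cons, Walk.support_ofSupport, List.mem_cons, or_iff_right_of_imp]
    rintro rfl
    exact List.getLast_mem hl

/-- Two disjoint cliques, not both empty, joined to an edge `xy` span a cycle. -/
theorem SimpleGraph.exists_isCycle_of_isClique {V : Type*} [DecidableEq V]
    {G : SimpleGraph V} {x y : V} {P Q : Finset V} (hP : G.IsClique P) (hQ : G.IsClique Q)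
    (hPQ : Disjoint P Q) (hxy : G.Adj x y) (hx : ∀ w ∈ P ∪ Q, G.Adj x w)
    (hy : ∀ w ∈ P ∪ Q, G.Adj y w) (hne : (P ∪ Q).Nonempty) :
    ∃ (v : V) (c : G.Walk v v), c.IsCycle ∧
      ∀ w, w ∈ c.support ↔ w = x ∨ w = y ∨ w ∈ P ∪ Q := by
  have hclique : ∀ {S : Finset V}, G.IsClique S → S.toList.IsChain G.Adj := fun {S} hS =>
    (S.nodup_toList.imp_of_mem fun ha hb hab =>
      hS (Finset.mem_toList.1 ha) (Finset.mem_toList.1 hb) hab).isChain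
  have hxm : x ∉ P ∪ Q := fun h => (hx x h).ne rfl
  have hym : y ∉ P ∪ Q := fun h => (hy y h).ne rfl
  have hcard := hne.card_pos
  rw [Finset.card_union_of_disjoint hPQ] at hcard
  simp only [Finset.mem_union, not_or] at hx hy hxm hym
  have hchain : (x :: (P.toList ++ y :: Q.toList)).IsChain G.Adj := by
    refine List.isChain_cons.2 ⟨fun w hw => ?_, List.isChain_append.2
      ⟨hclique hP, List.isChain_cons.2 ⟨fun w hw => ?_, hclique hQ⟩, fun a ha b hb => ?_⟩⟩
    · have := List.mem_of_mem_head? hw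
      simp only [List.mem_cons, List.mem_append, Finset.mem_toList] at this
      rcases this with h | rfl | h
      exacts [hx _ (.inl h), hxy, hx _ (.inr h)]
    · exact hy _ (.inr (Finset.mem_toList.1 (List.mem_of_mem_head? hw)))
    · obtain rfl : y = b := by simpa using hb
      exact (hy _ (.inl (Finset.mem_toList.1 (List.mem_of_mem_getLast? ha)))).symm
  have hnodup : (x :: (P.toList ++ y :: Q.toList)).Nodup := by
    simp only [List.nodup_cons, List.nodup_append, List.mem_cons, List.mem_append,
      Finset.mem_toList, Finset.nodup_toList, not_or]
    refine ⟨⟨hxm.1, hxy.ne, hxm.2⟩, trivial, ⟨hym.2, trivial⟩, ?_⟩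
    rintro a ha b (rfl | hb) rfl
    · exact hym.1 ha
    · exact Finset.disjoint_left.1 hPQ ha hb
  have hlen : 3 ≤ (x :: (P.toList ++ y :: Q.toList)).length := by
    simp only [List.length_cons, List.length_append, Finset.length_toList]
    omega
  have hclose : G.Adj ((x :: (P.toList ++ y :: Q.toList)).getLast (by simp))
      ((x :: (P.toList ++ y :: Q.toList)).head (by simp)) := by
    have h := List.getLast_mem (l := P.toList ++ y :: Q.toList) (by simp)
    rw [List.head_cons, List.getLast_cons (by simp)]
    simp only [List.mem_append, List.mem_cons, Finset.mem_toList] at h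
    rcases h with h | h | h
    · exact (hx _ (.inl h)).symm
    · rw [h]; exact hxy.symm
    · exact (hx _ (.inr h)).symm
  obtain ⟨v, c, hc, hs⟩ := exists_isCycle_of_isChain _ hchain hnodup hlen hclose
  refine ⟨v, c, hc, fun w => ?_⟩
  rw [hs]
  simp only [List.mem_cons, List.mem_append, Finset.mem_toList, Finset.mem_union]
  tauto

/-- For `n ≥ 5`, `1 ≤ m < n / 2` and `G = K_2 ∨ (K_m + K_{n-m-2})` with `x, y` the two vertices
of the `K_2`, the set `V(G) \ {x, y}` is a minimum H-force set of `G` and `h(G) = n - 2`. -/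
theorem stmt_16 (n m : ℕ) (hn : 5 ≤ n) (hm1 : 1 ≤ m) (hm2 : 2 * m < n)
    (G : SimpleGraph (Fin 2 ⊕ (Fin m ⊕ Fin (n - m - 2))))
    (hG : G = graphJoin (⊤ : SimpleGraph (Fin 2))
      ((⊤ : SimpleGraph (Fin m)) ⊕g (⊤ : SimpleGraph (Fin (n - m - 2))))) :
    IsMinHForceSet G (Finset.univ \ {Sum.inl 0, Sum.inl 1}) ∧ hForce G = n - 2 := by
  subst hG
  set G := graphJoin (⊤ : SimpleGraph (Fin 2))
      ((⊤ : SimpleGraph (Fin m)) ⊕g (⊤ : SimpleGraph (Fin (n - m - 2)))) with hG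
  have hxy : G.Adj (Sum.inl 0) (Sum.inl 1) := by simp [hG, graphJoin]
  have hcov : ∀ w : Fin 2 ⊕ (Fin m ⊕ Fin (n - m - 2)),
      w = .inl 0 ∨ w = .inl 1 ∨ (∃ i, w = .inr (.inl i)) ∨ ∃ j, w = .inr (.inr j) := by
    rintro (i | i | j)
    · fin_cases i <;> simp
    · simp
    · simp
  have hsep : ∀ u ∈ Set.range (fun i => (.inr (.inl i) : Fin 2 ⊕ (Fin m ⊕ Fin (n - m - 2)))),
      ∀ w, G.Adj u w → w ∈ Set.range (fun i => (.inr (.inl i) :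
        Fin 2 ⊕ (Fin m ⊕ Fin (n - m - 2)))) ∨ w = .inl 0 ∨ w = .inl 1 := by
    rintro _ ⟨i, rfl⟩ w hw
    rcases hcov w with h | h | ⟨j, rfl⟩ | ⟨j, rfl⟩
    · exact .inr (.inl h)
    · exact .inr (.inr h)
    · exact .inl ⟨j, rfl⟩
    · simp [hG, graphJoin] at hw
  have hcard : (Finset.univ \ {Sum.inl 0, Sum.inl 1} :
      Finset (Fin 2 ⊕ (Fin m ⊕ Fin (n - m - 2)))).card = n - 2 := by
    rw [Finset.card_sdiff_of_subset (Finset.subset_univ _), Finset.card_pair hxy.ne]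
    simp only [Finset.card_univ, Fintype.card_sum, Fintype.card_fin]
    omega
  have hforce : IsHForceSet G (Finset.univ \ {Sum.inl 0, Sum.inl 1}) := by
    refine ⟨Finset.card_pos.1 (by omega), fun v c hc h => ?_⟩
    have ha : .inr (.inl ⟨0, hm1⟩) ∈ c.support := h _ (by simp)
    have hb : .inr (.inr ⟨0, by omega⟩) ∈ c.support := h _ (by simp)
    have h0 : .inl 0 ∈ c.support :=
      hc.mem_support_of_separates hsep ⟨_, rfl⟩ (by simp) (by simp) (by simp) ha hb
    have h1 : .inl 1 ∈ c.support :=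
      hc.mem_support_of_separates (fun u hu w hw => (hsep u hu w hw).imp_right Or.symm)
        ⟨_, rfl⟩ (by simp) (by simp) (by simp) ha hb
    refine hc.isHamiltonianCycle_of_forall_mem_support fun w => ?_
    by_cases hw : w = .inl 0 ∨ w = .inl 1
    · rcases hw with rfl | rfl
      exacts [h0, h1]
    · exact h w (by simpa using hw)
  have hsub : ∀ Y, IsHForceSet G Y → Finset.univ \ {Sum.inl 0, Sum.inl 1} ⊆ Y := by
    intro Y hY v hv
    by_contra hvY
    let P : Finset (Fin 2 ⊕ (Fin m ⊕ Fin (n - m - 2))) :=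
      (Finset.univ.image fun i => .inr (.inl i)).erase v
    let Q : Finset (Fin 2 ⊕ (Fin m ⊕ Fin (n - m - 2))) :=
      (Finset.univ.image fun j => .inr (.inr j)).erase v
    have hPQ : P ∪ Q = (Finset.univ \ {Sum.inl 0, Sum.inl 1}).erase v := by
      ext w
      rcases hcov w with rfl | rfl | ⟨i, rfl⟩ | ⟨j, rfl⟩ <;> simp [P, Q]
    have hmem : ∀ w ∈ P ∪ Q, ∃ z, w = .inr z := by
      intro w hw
      rcases hcov w with rfl | rfl | ⟨i, rfl⟩ | ⟨j, rfl⟩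
      · simp [hPQ] at hw
      · simp [hPQ] at hw
      · exact ⟨_, rfl⟩
      · exact ⟨_, rfl⟩
    have hP : G.IsClique P := by
      intro a ha b hb hab
      simp only [P, Finset.coe_erase, Finset.coe_image, Finset.coe_univ, Set.image_univ] at ha hb
      obtain ⟨⟨i, rfl⟩, -⟩ := ha
      obtain ⟨⟨j, rfl⟩, -⟩ := hb
      simpa [hG, graphJoin] using hab
    have hQ : G.IsClique Q := by
      intro a ha b hb hab
      simp only [Q, Finset.coe_erase, Finset.coe_image, Finset.coe_univ, Set.image_univ] at ha hb
      obtain ⟨⟨i, rfl⟩, -⟩ := ha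
      obtain ⟨⟨j, rfl⟩, -⟩ := hb
      simpa [hG, graphJoin] using hab
    have hdisj : Disjoint P Q := by
      rw [Finset.disjoint_left]
      intro w hP hQ
      rcases hcov w with rfl | rfl | ⟨i, rfl⟩ | ⟨j, rfl⟩ <;> simp [P, Q] at hP hQ
    have hadj0 : ∀ w ∈ P ∪ Q, G.Adj (.inl 0) w := by
      intro w hw
      obtain ⟨z, rfl⟩ := hmem w hw
      simp [hG, graphJoin]
    have hadj1 : ∀ w ∈ P ∪ Q, G.Adj (.inl 1) w := by
      intro w hw
      obtain ⟨z, rfl⟩ := hmem w hw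
      simp [hG, graphJoin]
    have hne : (P ∪ Q).Nonempty := by
      rw [hPQ, ← Finset.card_pos, Finset.card_erase_of_mem hv]
      omega
    obtain ⟨u, c, hc, hs⟩ := exists_isCycle_of_isClique hP hQ hdisj hxy hadj0 hadj1 hne
    refine absurd ((hY.2 u c hc fun w hw => ?_).mem_support v) ?_
    · rw [hs, hPQ]
      have : w ≠ v := fun h => hvY (h ▸ hw)
      by_cases h0 : w = .inl 0 <;> by_cases h1 : w = .inl 1 <;> simp [h0, h1, this]
    · rw [hs, hPQ]
      simpa using hv
  have hmin : ∀ Y, IsHForceSet G Y → n - 2 ≤ Y.card := fun Y hY =>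
    hcard ▸ Finset.card_le_card (hsub Y hY)
  refine ⟨⟨hforce, fun Y hY => hcard ▸ hmin Y hY⟩, le_antisymm (Nat.sInf_le ⟨_, hforce, hcard⟩) ?_⟩
  refine le_csInf ⟨_, _, hforce, hcard⟩ ?_
  rintro _ ⟨Y, hY, rfl⟩
  exact hmin Y hY
end

section
/- Let m ≥ 2 and let G = K_{m+1} ∨ K^c_{m+1} be the join of a complete graph on m+1 vertices with an independent set of m+1 vertices, so G has n = 2m + 2 vertices. Then the independent set V(K^c_{m+1}) is an H-force set of G of minimum cardinality, and h(G) = n/2 = m + 1. -/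
open Finset SimpleGraph
open scoped Classical

/-- Dropping the first vertex of a cycle's support loses no vertex. -/
theorem SimpleGraph.Walk.IsCycle.mem_support_tail_iff {V : Type*} {G : SimpleGraph V} {v : V}
    {c : G.Walk v v} (hc : c.IsCycle) {x : V} : x ∈ c.support.tail ↔ x ∈ c.support := by
  refine ⟨List.mem_of_mem_tail, fun hx => ?_⟩
  rcases (Walk.mem_support_iff c).1 hx with rfl | hx
  · exact Walk.end_mem_tail_support hc.not_nil
  · exact hx

/-- In a cycle, every vertex is the source of some dart. -/
theorem SimpleGraph.Walk.IsCycle.exists_dart_fst_eq {V : Type*} {G : SimpleGraph V} {v : V}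
    {c : G.Walk v v} (hc : c.IsCycle) {x : V} (hx : x ∈ c.support) :
    ∃ d ∈ c.darts, d.fst = x := by
  have h : x ∈ c.darts.map (·.fst) := by
    rw [Walk.map_fst_darts, ← c.tail_support_perm_dropLast_support.mem_iff]
    exact hc.mem_support_tail_iff.2 hx
  simpa using h

/-- A cycle through an independent set made of half of the vertices is Hamiltonian. -/
theorem SimpleGraph.Walk.IsCycle.isHamiltonianCycle_of_isIndepSet {V : Type*} [Fintype V]
    [DecidableEq V] {G : SimpleGraph V} {I : Finset V} (hI : G.IsIndepSet I)
    (hcard : Fintype.card V = 2 * I.card) {v : V} {c : G.Walk v v} (hc : c.IsCycle)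
    (hmem : ∀ x ∈ I, x ∈ c.support) : c.IsHamiltonianCycle := by
  choose d hd hfst using fun i : I => hc.exists_dart_fst_eq (hmem i i.2)
  have hnodup : (c.darts.map (·.snd)).Nodup := by
    rw [Walk.map_snd_darts]
    exact hc.support_nodup
  have hinj : Function.Injective fun i => (d i).snd := fun i j hij =>
    Subtype.ext <| by
      rw [← hfst i, ← hfst j, List.inj_on_of_nodup_map hnodup (hd i) (hd j) hij]
  have hsub : Finset.univ.image (fun i => (d i).snd) ⊆ Iᶜ := by
    intro x hx
    obtain ⟨i, -, rfl⟩ := Finset.mem_image.1 hx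
    rw [Finset.mem_compl]
    intro hx
    have hadj := (d i).adj
    rw [hfst i] at hadj
    exact hI i.2 hx hadj.ne hadj
  have heq := Finset.eq_of_subset_of_card_le hsub <| by
    rw [Finset.card_compl, Finset.card_image_of_injective _ hinj, Finset.card_univ,
      Fintype.card_coe]
    omega
  refine Walk.isHamiltonianCycle_iff_isCycle_and_support_count_tail_eq_one.2 ⟨hc, fun x => ?_⟩
  refine List.count_eq_one_of_mem hc.support_nodup (hc.mem_support_tail_iff.2 ?_)
  by_cases hx : x ∈ I
  · exact hmem x hx
  · rw [← Finset.mem_compl, ← heq] at hx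
    obtain ⟨i, -, rfl⟩ := Finset.mem_image.1 hx
    exact c.dart_snd_mem_support_of_mem_darts (hd i)

/-- If all vertices of the two sides are adjacent to each other, there is a path alternating
between the two sides that follows given injective sequences on each side. -/
theorem exists_alternating_path {α β : Type*} {G : SimpleGraph (α ⊕ β)}
    (hG : ∀ a b, G.Adj (Sum.inl a) (Sum.inr b)) (f : ℕ → α) (g : ℕ → β) (k : ℕ)
    (hf : Set.InjOn f (Set.Iic k)) (hg : Set.InjOn g (Set.Iio k)) :
    ∃ p : G.Walk (Sum.inl (f 0)) (Sum.inl (f k)), p.IsPath ∧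
      (∀ x, x ∈ p.support ↔ (∃ j ≤ k, x = Sum.inl (f j)) ∨ ∃ j < k, x = Sum.inr (g j)) ∧
      ∀ a b, s(Sum.inl a, Sum.inl b) ∉ p.edges := by
  induction k with
  | zero => exact ⟨Walk.nil, by simp, by simp, by simp⟩
  | succ k ih =>
    obtain ⟨p, hp, hsupp, hedges⟩ := ih (hf.mono (Set.Iic_subset_Iic.2 k.le_succ))
      (hg.mono (Set.Iio_subset_Iio k.le_succ))
    have hgk : Sum.inr (g k) ∉ p.support := by
      rw [hsupp]
      rintro (⟨j, -, h⟩ | ⟨j, hj, h⟩)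
      · simp at h
      · exact hj.ne' (hg (Set.mem_Iio.2 k.lt_succ_self) (Set.mem_Iio.2 (by omega))
          (Sum.inr_injective h))
    have hfk : Sum.inl (f (k + 1)) ∉ (p.concat (hG (f k) (g k))).support := by
      rw [Walk.support_concat, List.mem_append, hsupp]
      rintro ((⟨j, hj, h⟩ | ⟨j, -, h⟩) | h)
      · have := hf (Set.mem_Iic.2 le_rfl) (Set.mem_Iic.2 (by omega)) (Sum.inl_injective h)
        omega
      · simp at h
      · simp at h
    refine ⟨(p.concat (hG (f k) (g k))).concat (hG (f (k + 1)) (g k)).symm,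
      (hp.concat hgk _).concat hfk _, fun x => ?_, fun a b => ?_⟩
    · simp only [Walk.support_concat, List.mem_append, List.mem_singleton, hsupp,
        Nat.le_succ_iff, Nat.lt_succ_iff_lt_or_eq, or_and_right, exists_or, exists_eq_left, Nat.succ_eq_add_one]
      rw [or_assoc, or_comm (a := x = Sum.inr _), or_or_or_comm]
    · simp [Walk.edges_concat, hedges]

/-- The H-force number is the cardinality of any minimum H-force set. -/
theorem IsMinHForceSet.hForce_eq {V : Type*} [Fintype V] [DecidableEq V] {G : SimpleGraph V}
    {X : Finset V} (hX : IsMinHForceSet G X) : hForce G = X.card := by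
  refine le_antisymm (Nat.sInf_le ⟨X, hX.1, rfl⟩) (le_csInf ⟨_, X, hX.1, rfl⟩ ?_)
  rintro _ ⟨Y, hY, rfl⟩
  exact hX.2 Y hY

/-- In `K_{m+1} ∨ K^c_{m+1}`, some cycle contains all vertices except a given one from the
independent side. -/
theorem exists_isCycle_mem_support_iff_ne_inr {m : ℕ} (hm : 1 ≤ m) (i : Fin (m + 1)) :
    ∃ (v : Fin (m + 1) ⊕ Fin (m + 1))
      (c : (graphJoin (⊤ : SimpleGraph (Fin (m + 1))) (⊥ : SimpleGraph (Fin (m + 1)))).Walk v v),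
      c.IsCycle ∧ ∀ x, x ∈ c.support ↔ x ≠ Sum.inr i := by
  let g : ℕ → Fin (m + 1) := fun j => if h : j < m then i.succAbove ⟨j, h⟩ else i
  have hg {j : ℕ} (h : j < m) : g j = i.succAbove ⟨j, h⟩ := dif_pos h
  obtain ⟨p, hp, hsupp, hedges⟩ := exists_alternating_path
    (G := graphJoin (⊤ : SimpleGraph (Fin (m + 1))) (⊥ : SimpleGraph (Fin (m + 1))))
    (by simp [graphJoin]) (Fin.ofNat (m + 1)) g m
    (by
      intro a ha b hb h
      have := congrArg Fin.val h
      simp only [Set.mem_Iic] at ha hb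
      simpa [Fin.ofNat, Nat.mod_eq_of_lt (Nat.lt_succ_of_le ha),
        Nat.mod_eq_of_lt (Nat.lt_succ_of_le hb)] using this)
    (by
      intro a ha b hb h
      rw [hg ha, hg hb] at h
      exact Fin.mk.inj (Fin.succAbove_right_injective h))
  have hne : Fin.ofNat (m + 1) m ≠ Fin.ofNat (m + 1) 0 := by
    simp [Fin.ext_iff, Fin.ofNat]
    omega
  refine ⟨_, Walk.cons (by simpa [graphJoin] using hne) p,
    (Walk.cons_isCycle_iff p _).2 ⟨hp, hedges _ _⟩, fun x => ?_⟩
  have hcons : x ∈ p.support ↔ x ≠ Sum.inr i := by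
    rw [hsupp]
    constructor
    · rintro (⟨j, -, rfl⟩ | ⟨j, hj, rfl⟩)
      · simp
      · rw [hg hj]
        simp
    · rcases x with a | b
      · exact fun _ => Or.inl ⟨a, by omega, by simp⟩
      · intro hb
        obtain ⟨j, rfl⟩ := Fin.exists_succAbove_eq (fun h => hb (congrArg Sum.inr h))
        exact Or.inr ⟨j, j.2, by rw [hg j.2]⟩
  rw [Walk.support_cons, List.mem_cons, hcons]
  exact or_iff_right_of_imp (by rintro rfl; simp)

/-- For `m ≥ 2` and `G = K_{m+1} ∨ K^c_{m+1}` (on `n = 2m + 2` vertices), the independent set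
`V(K^c_{m+1})` is a minimum H-force set of `G` and `h(G) = n / 2 = m + 1`. -/
theorem stmt_17 (m : ℕ) (hm : 2 ≤ m)
    (G : SimpleGraph (Fin (m + 1) ⊕ Fin (m + 1)))
    (hG : G = graphJoin (⊤ : SimpleGraph (Fin (m + 1))) (⊥ : SimpleGraph (Fin (m + 1)))) :
    IsMinHForceSet G (Finset.univ.image Sum.inr) ∧ hForce G = m + 1 := by
  subst hG
  have hcard : (Finset.univ.image (Sum.inr : Fin (m + 1) → Fin (m + 1) ⊕ Fin (m + 1))).card
      = m + 1 := by
    rw [Finset.card_image_of_injective _ Sum.inr_injective, Finset.card_univ, Fintype.card_fin]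
  have hmin : IsMinHForceSet (graphJoin (⊤ : SimpleGraph (Fin (m + 1)))
      (⊥ : SimpleGraph (Fin (m + 1)))) (Finset.univ.image Sum.inr) := by
    refine ⟨⟨by simp, fun v c hc hmem =>
      hc.isHamiltonianCycle_of_isIndepSet ?_ ?_ hmem⟩, fun Y hY => Finset.card_le_card ?_⟩
    · intro x hx y hy _
      simp only [Finset.coe_image, Finset.coe_univ, Set.image_univ, Set.mem_range] at hx hy
      obtain ⟨⟨a, rfl⟩, b, rfl⟩ := hx, hy
      simp [graphJoin]
    · rw [hcard, Fintype.card_sum, Fintype.card_fin]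
      omega
    · intro x hx
      obtain ⟨i, -, rfl⟩ := Finset.mem_image.1 hx
      by_contra hi
      obtain ⟨v, c, hc, hsupp⟩ := exists_isCycle_mem_support_iff_ne_inr (by omega : 1 ≤ m) i
      have hham := hY.2 v c hc fun y hy => (hsupp y).2 fun h => hi (h ▸ hy)
      exact (hsupp _).1 (hham.mem_support (Sum.inr i)) rfl
  exact ⟨hmin, hmin.hForce_eq.trans hcard⟩
end

section
/- Let n ≥ 6 be even and let G = K_{n/2,n/2} be the complete bipartite graph with both parts of size n/2. Then each part of the bipartition is an H-force set of G of minimum cardinality, and h(G) = n/2. -/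
open Finset SimpleGraph
open scoped Classical

namespace SimpleGraph

variable {α β : Type*}

/-- Along a walk of a complete bipartite graph, the signed number of vertices visited after the
start is determined by the sides of the two endpoints. -/
lemma Walk.two_mul_sum_support_tail_completeBipartiteGraph {u v : α ⊕ β}
    (p : (completeBipartiteGraph α β).Walk u v) :
    2 * (p.support.tail.map (Sum.elim (fun _ ↦ (1 : ℤ)) (fun _ ↦ -1))).sum =
      Sum.elim (fun _ ↦ 1) (fun _ ↦ -1) v - Sum.elim (fun _ ↦ 1) (fun _ ↦ -1) u := by
  induction p with
  | nil => simp
  | @cons u v w h p ih =>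
    rw [support_cons, List.tail_cons, ← p.cons_tail_support, List.map_cons, List.sum_cons,
      mul_add, ih]
    rcases u with u | u <;> rcases v with v | v <;> simp at h ⊢ <;> ring

lemma Walk.mem_support_tail_iff {V : Type*} {G : SimpleGraph V} {v x : V} (c : G.Walk v v)
    (hc : ¬ c.Nil) : x ∈ c.support.tail ↔ x ∈ c.support := by
  rw [c.mem_support_iff, iff_or_self]
  rintro rfl
  exact c.end_mem_tail_support hc

/-- A cycle of a complete bipartite graph meets both parts equally often. -/
lemma Walk.IsCycle.card_toLeft_eq_card_toRight [DecidableEq (α ⊕ β)] {v : α ⊕ β}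
    {c : (completeBipartiteGraph α β).Walk v v} (hc : c.IsCycle) :
    #c.support.toFinset.toLeft = #c.support.toFinset.toRight := by
  have hsum := c.two_mul_sum_support_tail_completeBipartiteGraph
  have htail : c.support.tail.toFinset = c.support.toFinset := by
    ext x
    simpa using c.mem_support_tail_iff hc.not_nil
  rw [sub_self, ← List.sum_toFinset _ hc.support_nodup, htail,
    ← toLeft_disjSum_toRight (u := c.support.toFinset), sum_disjSum] at hsum
  simp at hsum
  lia

/-- A cycle of a balanced complete bipartite graph that covers one part is Hamiltonian. -/
lemma Walk.IsCycle.isHamiltonianCycle_of_part [Fintype α] [Fintype β] [DecidableEq (α ⊕ β)]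
    (hcard : Fintype.card α = Fintype.card β) {v : α ⊕ β}
    {c : (completeBipartiteGraph α β).Walk v v} (hc : c.IsCycle)
    (h : (∀ a, .inl a ∈ c.support) ∨ ∀ b, .inr b ∈ c.support) : c.IsHamiltonianCycle := by
  have heq := hc.card_toLeft_eq_card_toRight
  have hparts : c.support.toFinset.toLeft = univ ∧ c.support.toFinset.toRight = univ := by
    rcases h with h | h
    · have hl : c.support.toFinset.toLeft = univ := by ext; simp [h]
      exact ⟨hl, by rw [← card_eq_iff_eq_univ, ← heq, hl, card_univ, hcard]⟩
    · have hr : c.support.toFinset.toRight = univ := by ext; simp [h]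
      exact ⟨by rw [← card_eq_iff_eq_univ, heq, hr, card_univ, hcard], hr⟩
  have hmem : ∀ x, x ∈ c.support := by
    rintro (a | b)
    · simpa using hparts.1.ge (mem_univ a)
    · simpa using hparts.2.ge (mem_univ b)
  refine ⟨hc, hc.isPath_tail.isHamiltonian_of_mem fun x ↦ ?_⟩
  rw [support_tail_of_not_nil _ hc.not_nil, c.mem_support_tail_iff hc.not_nil]
  exact hmem x

/-- Two nonempty sets of the same size on opposite sides of a complete bipartite graph are
together the vertex set of a path joining the two sides. -/
lemma exists_isPath_completeBipartiteGraph {A : Finset α} (hA : A.Nonempty) :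
    ∀ {B : Finset β}, #A = #B →
      ∃ a b, ∃ p : (completeBipartiteGraph α β).Walk (.inl a) (.inr b),
        p.IsPath ∧ p.length + 1 = 2 * #A ∧ ∀ x, x ∈ p.support ↔ x ∈ A.disjSum B := by
  induction hA using Finset.Nonempty.cons_induction with
  | singleton a =>
    intro B hB
    obtain ⟨b, rfl⟩ := card_eq_one.1 (hB.symm.trans (card_singleton a))
    have h : (completeBipartiteGraph α β).Adj (.inl a) (.inr b) := by simp
    refine ⟨a, b, h.toWalk, ?_, by simp, ?_⟩
    · simp [Walk.isPath_def]
    · rintro (x | x) <;> simp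
  | cons a A ha _ ih =>
    intro B hB
    rw [card_cons] at hB
    obtain ⟨b, hb⟩ : B.Nonempty := card_pos.1 (by lia)
    obtain ⟨a', b', p, hp, hlen, hsupp⟩ := @ih (B.erase b) (by rw [card_erase_of_mem hb]; lia)
    have h₁ : (completeBipartiteGraph α β).Adj (.inr b') (.inl a) := by simp
    have h₂ : (completeBipartiteGraph α β).Adj (.inl a) (.inr b) := by simp
    refine ⟨a', b, (p.concat h₁).concat h₂, (hp.concat ?_ h₁).concat ?_ h₂, ?_, ?_⟩
    · simp [hsupp, ha]
    · simp [Walk.support_concat, hsupp]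
    · simp only [Walk.length_concat, card_cons]
      lia
    · rintro (x | x)
      · simp [Walk.support_concat, hsupp, or_comm]
      · by_cases hx : x = b <;> simp [Walk.support_concat, hsupp, hx, hb]

/-- Two sets of the same size at least two on opposite sides of a complete bipartite graph are
together the vertex set of a cycle. -/
lemma exists_isCycle_completeBipartiteGraph {A : Finset α} {B : Finset β} (hA : 2 ≤ #A)
    (hAB : #A = #B) :
    ∃ v, ∃ c : (completeBipartiteGraph α β).Walk v v,
      c.IsCycle ∧ ∀ x, x ∈ c.support ↔ x ∈ A.disjSum B := by
  obtain ⟨a, b, p, hp, hlen, hsupp⟩ :=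
    exists_isPath_completeBipartiteGraph (card_pos.1 (by lia : 0 < #A)) hAB
  have h : (completeBipartiteGraph α β).Adj (.inr b) (.inl a) := by simp
  refine ⟨_, .cons h p, (p.cons_isCycle_iff h).2 ⟨hp, fun he ↦ ?_⟩, fun x ↦ ?_⟩
  · have := hp.length_eq_one_of_mem_edges (Sym2.eq_swap ▸ he)
    lia
  · rw [Walk.support_cons, List.mem_cons, hsupp]
    refine or_iff_right_of_imp ?_
    rintro rfl
    exact (hsupp _).1 p.end_mem_support

end SimpleGraph

/-- An H-force set of a balanced complete bipartite graph is at least as large as a part. -/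
lemma IsHForceSet.card_le_of_completeBipartiteGraph {α β : Type*} [Fintype α] [Fintype β]
    [DecidableEq (α ⊕ β)] (hcard : Fintype.card α = Fintype.card β) (hα : 3 ≤ Fintype.card α)
    {Y : Finset (α ⊕ β)} (hY : IsHForceSet (completeBipartiteGraph α β) Y) :
    Fintype.card α ≤ #Y := by
  by_contra! hlt
  obtain ⟨a, ha⟩ : ∃ a, a ∉ Y.toLeft := by
    by_contra! h
    have := card_toLeft_le (u := Y)
    rw [eq_univ_of_forall h, card_univ] at this
    lia
  obtain ⟨b, hb⟩ : ∃ b, b ∉ Y.toRight := by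
    by_contra! h
    have := card_toRight_le (u := Y)
    rw [eq_univ_of_forall h, card_univ] at this
    lia
  obtain ⟨v, c, hc, hsupp⟩ := exists_isCycle_completeBipartiteGraph
    (A := univ.erase a) (B := univ.erase b)
    (by rw [card_erase_of_mem (mem_univ a), card_univ]; lia)
    (by simp only [card_erase_of_mem (mem_univ _), card_univ, hcard])
  have hham := hY.2 v c hc fun x hx ↦ by
    rw [hsupp]
    rcases x with x | x
    · simpa using fun h : x = a ↦ ha (by simpa [h] using hx)
    · simpa using fun h : x = b ↦ hb (by simpa [h] using hx)
  simpa using (hsupp (.inl a)).1 (hham.mem_support _)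

/-- For even `n ≥ 6` and `G = K_{n/2, n/2}`, each part of the bipartition is a minimum H-force
set of `G`, and `h(G) = n / 2`. -/
theorem stmt_18 (n : ℕ) (hn : 6 ≤ n) (heven : Even n)
    (G : SimpleGraph (Fin (n / 2) ⊕ Fin (n / 2)))
    (hG : G = completeBipartiteGraph (Fin (n / 2)) (Fin (n / 2))) :
    IsMinHForceSet G (Finset.univ.image Sum.inl) ∧
    IsMinHForceSet G (Finset.univ.image Sum.inr) ∧
    hForce G = n / 2 := by
  have hm : 3 ≤ n / 2 := by lia
  subst hG
  have hle : ∀ Y : Finset (Fin (n / 2) ⊕ Fin (n / 2)),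
      IsHForceSet (completeBipartiteGraph (Fin (n / 2)) (Fin (n / 2))) Y → n / 2 ≤ #Y :=
    fun Y hY ↦ by simpa using hY.card_le_of_completeBipartiteGraph rfl (by simpa using hm)
  have hne : (univ : Finset (Fin (n / 2))).Nonempty := ⟨⟨0, by lia⟩, mem_univ _⟩
  have hcl : #(univ.image (Sum.inl : Fin (n / 2) → Fin (n / 2) ⊕ Fin (n / 2))) = n / 2 := by
    simp [card_image_of_injective _ Sum.inl_injective]
  have hcr : #(univ.image (Sum.inr : Fin (n / 2) → Fin (n / 2) ⊕ Fin (n / 2))) = n / 2 := by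
    simp [card_image_of_injective _ Sum.inr_injective]
  have hl : IsHForceSet (completeBipartiteGraph (Fin (n / 2)) (Fin (n / 2)))
      (univ.image Sum.inl) :=
    ⟨hne.image _, fun v c hc h ↦ hc.isHamiltonianCycle_of_part rfl
      (.inl fun a ↦ h _ (mem_image_of_mem _ (mem_univ a)))⟩
  have hr : IsHForceSet (completeBipartiteGraph (Fin (n / 2)) (Fin (n / 2)))
      (univ.image Sum.inr) :=
    ⟨hne.image _, fun v c hc h ↦ hc.isHamiltonianCycle_of_part rfl
      (.inr fun b ↦ h _ (mem_image_of_mem _ (mem_univ b)))⟩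
  refine ⟨⟨hl, fun Y hY ↦ hcl.trans_le (hle Y hY)⟩, ⟨hr, fun Y hY ↦ hcr.trans_le (hle Y hY)⟩, ?_⟩
  refine IsLeast.csInf_eq ⟨⟨_, hl, hcl⟩, ?_⟩
  rintro _ ⟨Y, hY, rfl⟩
  exact hle Y hY
end

section
/- Let G be a Hamiltonian simple graph with n ≥ 4 vertices such that for every vertex v, the graph G − v is Hamiltonian. Then V(G) is the only H-force set of G, and h(G) = n. -/
open Finset SimpleGraph
open scoped Classical

/-- A cycle visiting every vertex is a Hamiltonian cycle. -/
theorem isHamiltonianCycle_of_isCycle_of_forall_mem_support {V : Type*} [DecidableEq V]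
    {G : SimpleGraph V} {v : V} {c : G.Walk v v} (hc : c.IsCycle)
    (h : ∀ x, x ∈ c.support) : c.IsHamiltonianCycle := by
  rw [Walk.isHamiltonianCycle_iff_isCycle_and_support_count_tail_eq_one]
  refine ⟨hc, fun x => List.count_eq_one_of_mem hc.support_nodup ?_⟩
  rcases (Walk.mem_support_iff c).mp (h x) with rfl | hx
  · exact Walk.end_mem_tail_support hc.not_nil
  · exact hx

/-- If `G - v` is Hamiltonian and has at least two vertices, then `G` has a cycle visiting exactly
the vertices other than `v`. -/
theorem exists_isCycle_mem_support_iff_ne {V : Type*} [Fintype V] [DecidableEq V]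
    {G : SimpleGraph V} {v : V} (hn : 3 ≤ Fintype.card V)
    (hv : (G.induce ({v}ᶜ : Set V)).IsHamiltonian) :
    ∃ (w : V) (c : G.Walk w w), c.IsCycle ∧ ∀ x, x ∈ c.support ↔ x ≠ v := by
  have hcard : Fintype.card ({v}ᶜ : Set V) ≠ 1 := by
    rw [Fintype.card_compl_set]
    simp
    omega
  obtain ⟨w, c, hc⟩ := hv hcard
  refine ⟨_, c.map (Embedding.induce _).toHom, hc.isCycle.map Subtype.val_injective, fun x => ?_⟩
  rw [Walk.support_map, List.mem_map]
  constructor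
  · rintro ⟨y, -, rfl⟩
    exact y.2
  · exact fun hx => ⟨⟨x, hx⟩, hc.mem_support _, rfl⟩

/-- If `G` is a Hamiltonian graph with `n ≥ 4` vertices such that `G - v` is Hamiltonian for
every vertex `v`, then `V(G)` is the only H-force set of `G` and `h(G) = n`. -/
theorem stmt_19 {V : Type*} [Fintype V] [DecidableEq V] (G : SimpleGraph V)
    (hn : 4 ≤ Fintype.card V) (hG : G.IsHamiltonian)
    (hdel : ∀ v : V, (G.induce ({v}ᶜ : Set V)).IsHamiltonian) :
    (∀ X : Finset V, IsHForceSet G X ↔ X = Finset.univ) ∧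
    hForce G = Fintype.card V := by
  have key : ∀ X : Finset V, IsHForceSet G X ↔ X = Finset.univ := by
    refine fun X => ⟨fun hX => Finset.eq_univ_of_forall fun v => ?_, ?_⟩
    · by_contra hv
      obtain ⟨w, c, hc, hsupp⟩ := exists_isCycle_mem_support_iff_ne (by omega) (hdel v)
      have hham := hX.2 w c hc fun x hx => (hsupp x).mpr (ne_of_mem_of_not_mem hx hv)
      exact (hsupp v).mp (hham.mem_support v) rfl
    · rintro rfl
      have : Nonempty V := Fintype.card_pos_iff.mp (by omega)
      exact ⟨Finset.univ_nonempty, fun v c hc h =>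
        isHamiltonianCycle_of_isCycle_of_forall_mem_support hc fun x => h x (Finset.mem_univ x)⟩
  refine ⟨key, ?_⟩
  simp [hForce, key]
end
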